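/- Let x ∈ X, r > 0, and let E ⊂ X be a μ-measurable set with μ(E ∩ B(x,2r))/μ(B(x,2r)) ≤ 1/(2 C_d^{⌈log₂(128λ)⌉}). Then cap₁((I_E ∪ ∂*E) ∩ B(x,r), B(x,2r)) ≤ C₃ P(E, B(x,2r)), where C₃ is a constant depending only on C_d, C_P, and λ. -/

import Mathlib

open MeasureTheory Metric Filter Set
open scoped ENNReal NNReal Topology

noncomputable section

namespace MetricBV

variable {X : Type*} [MetricSpace X] [MeasurableSpace X]

/-- A rectifiable curve, encoded as a Lipschitz map on the interval `[0,1]`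
(every rectifiable curve admits such a reparametrization). -/
structure Curve (X : Type*) [MetricSpace X] where
  toFun : ℝ → X
  lipschitz : ∃ K : ℝ≥0, LipschitzOnWith K toFun (Set.Icc 0 1)

/-- The metric speed of a curve at a point. -/
def speed (γ : ℝ → X) (t : ℝ) : ℝ≥0∞ :=
  Filter.limsup (fun h : ℝ => ENNReal.ofReal (dist (γ (t + h)) (γ t) / |h|)) (𝓝[≠] (0 : ℝ))

/-- The curve integral `∫_γ g ds`. -/
def curveIntegral (g : X → ℝ≥0∞) (γ : Curve X) : ℝ≥0∞ :=
  ∫⁻ t in Set.Icc (0 : ℝ) 1, g (γ.toFun t) * speed γ.toFun t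

/-- A curve lies in a set `Ω`. -/
def Curve.In (γ : Curve X) (Ω : Set X) : Prop :=
  ∀ t ∈ Set.Icc (0 : ℝ) 1, γ.toFun t ∈ Ω

/-- The 1-modulus of a family of curves. -/
def Mod1 (μ : Measure X) (Γ : Set (Curve X)) : ℝ≥0∞ :=
  ⨅ (ρ : X → ℝ≥0∞) (_ : Measurable ρ) (_ : ∀ γ ∈ Γ, 1 ≤ curveIntegral ρ γ),
    ∫⁻ x, ρ x ∂μ

/-- `g` is an upper gradient of `u` in `Ω`: the upper gradient inequality holds
along every curve contained in `Ω`. -/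
def IsUpperGradientOn (g : X → ℝ≥0∞) (u : X → ℝ) (Ω : Set X) : Prop :=
  ∀ γ : Curve X, γ.In Ω →
    ENNReal.ofReal |u (γ.toFun 1) - u (γ.toFun 0)| ≤ curveIntegral g γ

/-- `g` is a 1-weak upper gradient of `u` in `Ω`: the upper gradient inequality holds
along every curve in `Ω` outside a family of zero 1-modulus. -/
def IsWeakUpperGradientOn (μ : Measure X) (g : X → ℝ≥0∞) (u : X → ℝ) (Ω : Set X) : Prop :=
  ∃ Γ : Set (Curve X), Mod1 μ Γ = 0 ∧
    ∀ γ : Curve X, γ ∉ Γ → γ.In Ω →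
      ENNReal.ofReal |u (γ.toFun 1) - u (γ.toFun 0)| ≤ curveIntegral g γ

/-- Membership in the Newtonian space `N^{1,1}(X)`. -/
def MemN11 (μ : Measure X) (u : X → ℝ) : Prop :=
  Integrable u μ ∧ ∃ g : X → ℝ≥0∞, Measurable g ∧
    IsWeakUpperGradientOn μ g u Set.univ ∧ ∫⁻ x, g x ∂μ < ⊤

/-- The 1-capacity `cap₁(A) = inf ‖u‖_{N^{1,1}(X)}` over `u ∈ N^{1,1}(X)` with `u ≥ 1` on `A`. -/
def cap1 (μ : Measure X) (A : Set X) : ℝ≥0∞ :=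
  ⨅ (u : X → ℝ) (_ : MemN11 μ u) (_ : ∀ x ∈ A, 1 ≤ u x)
    (g : X → ℝ≥0∞) (_ : Measurable g) (_ : IsWeakUpperGradientOn μ g u Set.univ),
    (∫⁻ x, ENNReal.ofReal |u x| ∂μ + ∫⁻ x, g x ∂μ)

/-- The variational 1-capacity `cap₁(A,Ω) = inf ∫ g_u dμ` over `u ∈ N^{1,1}(X)` with
`u ≥ 1` on `A` and `u = 0` on `X ∖ Ω`. -/
def vcap1 (μ : Measure X) (A Ω : Set X) : ℝ≥0∞ :=
  ⨅ (u : X → ℝ) (_ : MemN11 μ u) (_ : ∀ x ∈ A, 1 ≤ u x) (_ : ∀ x ∈ Ωᶜ, u x = 0)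
    (g : X → ℝ≥0∞) (_ : Measurable g) (_ : IsWeakUpperGradientOn μ g u Set.univ),
    ∫⁻ x, g x ∂μ

/-- Locally Lipschitz in `Ω`: Lipschitz on every compact subset of `Ω`. -/
def LocLipschitzOn (u : X → ℝ) (Ω : Set X) : Prop :=
  ∀ K : Set X, IsCompact K → K ⊆ Ω → ∃ L : ℝ≥0, LipschitzOnWith L u K

/-- Convergence `v i → u` in `L¹_loc(Ω)`. -/
def TendstoL1Loc (μ : Measure X) (v : ℕ → X → ℝ) (u : X → ℝ) (Ω : Set X) : Prop :=
  ∀ K : Set X, IsCompact K → K ⊆ Ω →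
    Filter.Tendsto (fun i => ∫⁻ x in K, ENNReal.ofReal |v i x - u x| ∂μ)
      Filter.atTop (𝓝 0)

/-- The total variation `‖Du‖(Ω)` of `u` in an open set `Ω`: the infimum of
`liminf ∫_Ω g_i dμ` over sequences of locally Lipschitz functions `v i → u` in `L¹_loc(Ω)`
with `g i` a 1-weak upper gradient of `v i` in `Ω`. -/
def tv (μ : Measure X) (u : X → ℝ) (Ω : Set X) : ℝ≥0∞ :=
  ⨅ (v : ℕ → X → ℝ) (_ : ∀ i, LocLipschitzOn (v i) Ω) (_ : TendstoL1Loc μ v u Ω)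
    (g : ℕ → X → ℝ≥0∞) (_ : ∀ i, Measurable (g i))
    (_ : ∀ i, IsWeakUpperGradientOn μ (g i) (v i) Ω),
    Filter.liminf (fun i => ∫⁻ x in Ω, g i x ∂μ) Filter.atTop

/-- The total variation `‖Du‖(A)` for an arbitrary set `A`. -/
def tvs (μ : Measure X) (u : X → ℝ) (A : Set X) : ℝ≥0∞ :=
  ⨅ (U : Set X) (_ : IsOpen U) (_ : A ⊆ U), tv μ u U

/-- The characteristic function of a set, as a real-valued function. -/
def chi (E : Set X) : X → ℝ := Set.indicator E fun _ => (1 : ℝ)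

/-- The perimeter `P(E,Ω) = ‖Dχ_E‖(Ω)` of `E` in an open set `Ω`. -/
def perim (μ : Measure X) (E : Set X) (Ω : Set X) : ℝ≥0∞ := tv μ (chi E) Ω

/-- `u ∈ BV(Ω)`: `u ∈ L¹(Ω)` and `‖Du‖(Ω) < ∞`. -/
def MemBV (μ : Measure X) (u : X → ℝ) (Ω : Set X) : Prop :=
  IntegrableOn u Ω μ ∧ tv μ u Ω < ⊤

/-- `u ∈ BV_loc(Ω)`. -/
def MemBVloc (μ : Measure X) (u : X → ℝ) (Ω : Set X) : Prop :=
  ∀ K : Set X, IsCompact K → K ⊆ Ω → ∃ U : Set X, IsOpen U ∧ K ⊆ U ∧ U ⊆ Ω ∧ MemBV μ u U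

/-- `φ ∈ BV_c(Ω)`: a BV function with compact support in `Ω`. -/
def MemBVc (μ : Measure X) (φ : X → ℝ) (Ω : Set X) : Prop :=
  MemBV μ φ Ω ∧ IsCompact (tsupport φ) ∧ tsupport φ ⊆ Ω

/-- `u` is a 1-minimizer (function of least gradient) in `Ω`. -/
def IsMinimizer (μ : Measure X) (u : X → ℝ) (Ω : Set X) : Prop :=
  MemBVloc μ u Ω ∧ ∀ φ : X → ℝ, MemBVc μ φ Ω →
    tvs μ u (tsupport φ) ≤ tvs μ (fun y => u y + φ y) (tsupport φ)

/-- `u` is a 1-superminimizer in `Ω`. -/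
def IsSuperminimizer (μ : Measure X) (u : X → ℝ) (Ω : Set X) : Prop :=
  MemBVloc μ u Ω ∧ ∀ φ : X → ℝ, MemBVc μ φ Ω → (∀ x, 0 ≤ φ x) →
    tvs μ u (tsupport φ) ≤ tvs μ (fun y => u y + φ y) (tsupport φ)

/-- `u` is a 1-subminimizer in `Ω`. -/
def IsSubminimizer (μ : Measure X) (u : X → ℝ) (Ω : Set X) : Prop :=
  MemBVloc μ u Ω ∧ ∀ φ : X → ℝ, MemBVc μ φ Ω → (∀ x, φ x ≤ 0) →
    tvs μ u (tsupport φ) ≤ tvs μ (fun y => u y + φ y) (tsupport φ)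

/-- The lower approximate limit `u^∧(x)`, with values in `[-∞,∞]`. -/
def lowerApprox (μ : Measure X) (u : X → ℝ) (x : X) : EReal :=
  sSup ((fun t : ℝ => (t : EReal)) '' {t : ℝ | Filter.Tendsto
    (fun r : ℝ => μ ({y | u y < t} ∩ Metric.ball x r) / μ (Metric.ball x r))
    (𝓝[>] (0 : ℝ)) (𝓝 0)})

/-- The upper approximate limit `u^∨(x)`, with values in `[-∞,∞]`. -/
def upperApprox (μ : Measure X) (u : X → ℝ) (x : X) : EReal :=
  sInf ((fun t : ℝ => (t : EReal)) '' {t : ℝ | Filter.Tendsto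
    (fun r : ℝ => μ ({y | t < u y} ∩ Metric.ball x r) / μ (Metric.ball x r))
    (𝓝[>] (0 : ℝ)) (𝓝 0)})

/-- The upper approximate limit of an extended-real-valued function. -/
def upperApproxE (μ : Measure X) (ψ : X → EReal) (x : X) : EReal :=
  sInf ((fun t : ℝ => (t : EReal)) '' {t : ℝ | Filter.Tendsto
    (fun r : ℝ => μ ({y | (t : EReal) < ψ y} ∩ Metric.ball x r) / μ (Metric.ball x r))
    (𝓝[>] (0 : ℝ)) (𝓝 0)})

/-- The measure-theoretic interior `I_E`. -/
def measInterior (μ : Measure X) (E : Set X) : Set X :=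
  {x : X | Filter.Tendsto (fun r : ℝ => μ (Metric.ball x r \ E) / μ (Metric.ball x r))
    (𝓝[>] (0 : ℝ)) (𝓝 0)}

/-- The measure-theoretic boundary `∂*E`. -/
def measBoundary (μ : Measure X) (E : Set X) : Set X :=
  {x : X | 0 < Filter.limsup (fun r : ℝ => μ (Metric.ball x r ∩ E) / μ (Metric.ball x r))
      (𝓝[>] (0 : ℝ)) ∧
    0 < Filter.limsup (fun r : ℝ => μ (Metric.ball x r \ E) / μ (Metric.ball x r))
      (𝓝[>] (0 : ℝ))}

/-- `A` is 1-thin at `x`. -/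
def IsThinAt (μ : Measure X) (A : Set X) (x : X) : Prop :=
  Filter.Tendsto (fun r : ℝ =>
      ENNReal.ofReal r * vcap1 μ (A ∩ Metric.ball x r) (Metric.ball x (2 * r))
        / μ (Metric.ball x r))
    (𝓝[>] (0 : ℝ)) (𝓝 0)

/-- `U` is 1-finely open. -/
def IsFinelyOpen (μ : Measure X) (U : Set X) : Prop :=
  ∀ x ∈ U, IsThinAt μ Uᶜ x

/-- The class `K_{ψ,f}(Ω)` of admissible functions for the obstacle problem. -/
def MemK (μ : Measure X) (ψ : X → EReal) (f : X → ℝ) (Ω : Set X) (u : X → ℝ) : Prop :=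
  MemBVloc μ u Set.univ ∧ (∀ᵐ x ∂μ, x ∈ Ω → ψ x ≤ (u x : EReal)) ∧
    (∀ᵐ x ∂μ, x ∉ Ω → u x = f x)

/-- `u` is a solution of the `K_{ψ,f}(Ω)`-obstacle problem. -/
def IsObstacleSolution (μ : Measure X) (ψ : X → EReal) (f : X → ℝ) (Ω : Set X)
    (u : X → ℝ) : Prop :=
  MemK μ ψ f Ω u ∧ ∀ v : X → ℝ, MemK μ ψ f Ω v → tv μ u Set.univ ≤ tv μ v Set.univ

/-- The standing assumptions: `(X,d,μ)` is a complete metric space with at least two points,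
`μ` is a doubling measure with constant `Cd`, and `X` supports a `(1,1)`-Poincaré inequality
with constants `CP`, `lam`. -/
structure MMS {X : Type*} [MetricSpace X] [MeasurableSpace X] (μ : Measure X)
    (Cd CP lam : ℝ) : Prop where
  complete : CompleteSpace X
  nontrivial : Nontrivial X
  hCd : 1 ≤ Cd
  hCP : 0 < CP
  hlam : 1 ≤ lam
  doubling : ∀ (x : X) (r : ℝ), 0 < r →
    0 < μ (Metric.ball x (2 * r)) ∧
    μ (Metric.ball x (2 * r)) ≤ ENNReal.ofReal Cd * μ (Metric.ball x r) ∧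
    μ (Metric.ball x r) < ⊤
  poincare : ∀ (x : X) (r : ℝ), 0 < r → ∀ u : X → ℝ, MeasureTheory.LocallyIntegrable u μ →
    ∀ g : X → ℝ≥0∞, Measurable g → IsUpperGradientOn g u Set.univ →
      ∫⁻ y in Metric.ball x r, ENNReal.ofReal |u y - ⨍ z in Metric.ball x r, u z ∂μ| ∂μ ≤
        ENNReal.ofReal (CP * r) * (μ (Metric.ball x r) / μ (Metric.ball x (lam * r))) *
          ∫⁻ y in Metric.ball x (lam * r), g y ∂μ

/-! ### Curves -/

omit [MeasurableSpace X] in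
theorem Curve.continuousOn (γ : Curve X) : ContinuousOn γ.toFun (Icc 0 1) :=
  γ.lipschitz.choose_spec.continuousOn

/-- The restriction of a curve to `[a, b]`, reparametrized on `[0, 1]`. -/
def Curve.sub (γ : Curve X) {a b : ℝ} (ha : 0 ≤ a) (hab : a < b) (hb : b ≤ 1) : Curve X where
  toFun s := γ.toFun (a + (b - a) * s)
  lipschitz := by
    obtain ⟨K, hK⟩ := γ.lipschitz
    refine ⟨K * Real.toNNReal (b - a), LipschitzOnWith.of_dist_le_mul fun s hs t ht => ?_⟩
    have h0 : 0 ≤ b - a := by linarith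
    refine (hK.dist_le_mul _ ?_ _ ?_).trans (le_of_eq ?_)
    · constructor <;> nlinarith [hs.1, hs.2]
    · constructor <;> nlinarith [ht.1, ht.2]
    · rw [Real.dist_eq, Real.dist_eq, NNReal.coe_mul, Real.coe_toNNReal _ h0,
        show a + (b - a) * s - (a + (b - a) * t) = (b - a) * (s - t) by ring, abs_mul,
        abs_of_nonneg h0]
      ring

omit [MeasurableSpace X] in
theorem Curve.sub_in {γ : Curve X} {a b : ℝ} {ha : 0 ≤ a} {hab : a < b} {hb : b ≤ 1} {Ω : Set X}
    (h : ∀ t ∈ Icc a b, γ.toFun t ∈ Ω) : (γ.sub ha hab hb).In Ω := by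
  intro s hs
  refine h _ ⟨?_, ?_⟩ <;> nlinarith [hs.1, hs.2]

omit [MeasurableSpace X] in
theorem speed_affine (γ : ℝ → X) {a c : ℝ} (hc : 0 < c) (s : ℝ) :
    speed (fun t => γ (a + c * t)) s = ENNReal.ofReal c * speed γ (a + c * s) := by
  have hmap : Filter.map (fun h : ℝ => c * h) (𝓝[≠] (0 : ℝ)) = 𝓝[≠] (0 : ℝ) := by
    have := (Homeomorph.mulLeft₀ c hc.ne').isEmbedding.map_nhdsWithin_eq {0}ᶜ 0
    simp only [Homeomorph.coe_mulLeft₀, mul_zero] at this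
    rw [this]
    congr 1
    ext y
    simp only [mem_image, mem_compl_iff, mem_singleton_iff]
    constructor
    · rintro ⟨x, hx, rfl⟩
      exact mul_ne_zero hc.ne' hx
    · intro hy
      exact ⟨y / c, div_ne_zero hy hc.ne', by field_simp⟩
  unfold speed
  rw [← ENNReal.limsup_const_mul_of_ne_top ENNReal.ofReal_ne_top]
  conv_rhs => rw [← hmap]
  rw [Filter.limsup, Filter.limsup, Filter.map_map]
  congr 2
  funext h
  simp only [Function.comp]
  rw [← ENNReal.ofReal_mul hc.le, abs_mul, abs_of_pos hc,
    show a + c * (s + h) = a + c * s + c * h by ring]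
  congr 1
  by_cases hh : h = 0
  · simp [hh]
  · have : |h| ≠ 0 := abs_ne_zero.2 hh
    field_simp

omit [MeasurableSpace X] in
theorem curveIntegral_sub (g : X → ℝ≥0∞) (γ : Curve X) {a b : ℝ} (ha : 0 ≤ a) (hab : a < b)
    (hb : b ≤ 1) :
    curveIntegral g (γ.sub ha hab hb) = ∫⁻ t in Icc a b, g (γ.toFun t) * speed γ.toFun t := by
  have hc : 0 < b - a := by linarith
  set F : ℝ → ℝ≥0∞ := fun t => g (γ.toFun t) * speed γ.toFun t with hF
  let e : ℝ ≃ᵐ ℝ := (Homeomorph.mulLeft₀ (b - a) hc.ne').toMeasurableEquiv.trans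
    (Homeomorph.addLeft a).toMeasurableEquiv
  have he : ∀ s, e s = a + (b - a) * s := fun s => rfl
  have hmap : Measure.map e volume = ENNReal.ofReal (b - a)⁻¹ • volume := by
    have h1 : (e : ℝ → ℝ) = (fun t => a + t) ∘ (fun t => (b - a) * t) := by
      funext s; exact he s
    rw [h1, ← Measure.map_map (by fun_prop) (by fun_prop), Real.map_volume_mul_left hc.ne',
      Measure.map_smul, map_add_left_eq_self, abs_of_pos (inv_pos.2 hc)]
  have h2 : curveIntegral g (γ.sub ha hab hb)
      = ∫⁻ s in Icc (0 : ℝ) 1, ENNReal.ofReal (b - a) * F (e s) := by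
    unfold curveIntegral
    refine lintegral_congr fun s => ?_
    have := speed_affine γ.toFun (a := a) hc s
    simp only [Curve.sub, hF, he]
    rw [this]
    ring
  have h3 : Icc (0 : ℝ) 1 = e ⁻¹' Icc a b := by
    ext s
    simp only [mem_Icc, mem_preimage, he]
    constructor
    · rintro ⟨h, h'⟩; constructor <;> nlinarith
    · rintro ⟨h, h'⟩
      constructor
      · by_contra hs; nlinarith
      · by_contra hs; nlinarith
  rw [h2, lintegral_const_mul' _ _ ENNReal.ofReal_ne_top, h3, ← lintegral_map_equiv F e,
    ← e.measurableEmbedding.restrict_map, hmap, Measure.restrict_smul, lintegral_smul_measure,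
    smul_eq_mul, ← mul_assoc, ← ENNReal.ofReal_mul hc.le, mul_inv_cancel₀ hc.ne',
    ENNReal.ofReal_one, one_mul]

omit [MeasurableSpace X] in
theorem curveIntegral_sub_le (g : X → ℝ≥0∞) (γ : Curve X) {a b : ℝ} (ha : 0 ≤ a) (hab : a < b)
    (hb : b ≤ 1) : curveIntegral g (γ.sub ha hab hb) ≤ curveIntegral g γ := by
  rw [curveIntegral_sub]
  exact lintegral_mono_set (Icc_subset_Icc ha hb)

omit [MeasurableSpace X] in
theorem curveIntegral_mono {g g' : X → ℝ≥0∞} (h : ∀ x, g x ≤ g' x) (γ : Curve X) :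
    curveIntegral g γ ≤ curveIntegral g' γ :=
  lintegral_mono fun _ => mul_le_mul_left (h _) _

omit [MeasurableSpace X] in
/-- The upper gradient inequality for a Lipschitz function that is extremal outside `A`. -/
theorem lipschitz_le_curveIntegral {φ : X → ℝ} {L : ℝ} (hL : 0 ≤ L)
    (hφ : ∀ x y, |φ x - φ y| ≤ L * dist x y) {A : Set X}
    (hA : ∀ x ∉ A, (∀ y, φ x ≤ φ y) ∨ ∀ y, φ y ≤ φ x) (γ : Curve X) :
    ENNReal.ofReal |φ (γ.toFun 1) - φ (γ.toFun 0)| ≤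
      curveIntegral (A.indicator fun _ => ENNReal.ofReal L) γ := by
  obtain ⟨K, hK⟩ := γ.lipschitz
  set f : ℝ → ℝ := fun t => φ (γ.toFun t) with hf
  have hfL : LipschitzOnWith (Real.toNNReal L * K) f (uIcc 0 1) := by
    rw [uIcc_of_le zero_le_one]
    refine LipschitzOnWith.of_dist_le_mul fun s hs t ht => ?_
    rw [Real.dist_eq, NNReal.coe_mul, Real.coe_toNNReal _ hL, mul_assoc]
    exact (hφ _ _).trans (mul_le_mul_of_nonneg_left (hK.dist_le_mul _ hs _ ht) hL)
  have hac := hfL.absolutelyContinuousOnInterval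
  have hint := hac.integral_deriv_eq_sub
  have hdiff := hac.ae_differentiableAt
  have h1 : ENNReal.ofReal |f 1 - f 0| ≤ ∫⁻ t in Icc (0 : ℝ) 1, ENNReal.ofReal |deriv f t| := by
    rw [← hint, intervalIntegral.integral_of_le zero_le_one, ← Real.norm_eq_abs,
      ofReal_norm]
    refine (enorm_integral_le_lintegral_enorm _).trans ?_
    refine (lintegral_mono_set Ioc_subset_Icc_self).trans (le_of_eq ?_)
    refine lintegral_congr fun t => ?_
    rw [← Real.norm_eq_abs, ofReal_norm]
  refine h1.trans ?_
  unfold curveIntegral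
  rw [← restrict_Ioo_eq_restrict_Icc]
  refine lintegral_mono_ae ?_
  rw [ae_restrict_iff' measurableSet_Ioo]
  filter_upwards [hdiff] with t ht htI
  have htd := ht (by rw [uIcc_of_le zero_le_one]; exact Ioo_subset_Icc_self htI)
  by_cases hmem : γ.toFun t ∈ A
  · rw [indicator_of_mem hmem]
    have hlim : Tendsto (fun h : ℝ => ENNReal.ofReal |h⁻¹ • (f (t + h) - f t)|) (𝓝[≠] 0)
        (𝓝 (ENNReal.ofReal |deriv f t|)) :=
      (ENNReal.continuous_ofReal.tendsto _).comp
        ((continuous_abs.tendsto _).comp htd.hasDerivAt.tendsto_slope_zero)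
    rw [← hlim.limsup_eq]
    unfold speed
    rw [← ENNReal.limsup_const_mul_of_ne_top ENNReal.ofReal_ne_top]
    refine limsup_le_limsup (Eventually.of_forall fun h => ?_)
    beta_reduce
    rw [← ENNReal.ofReal_mul hL]
    refine ENNReal.ofReal_le_ofReal ?_
    rw [smul_eq_mul, abs_mul, abs_inv, mul_div_assoc', inv_mul_eq_div]
    exact div_le_div_of_nonneg_right (hφ _ _) (abs_nonneg _)
  · have h0 : deriv f t = 0 := by
      rcases hA _ hmem with h | h
      · exact (IsLocalMin.deriv_eq_zero (Eventually.of_forall fun s => h _))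
      · exact (IsLocalMax.deriv_eq_zero (Eventually.of_forall fun s => h _))
    simp [h0]

/-- Adding an integrable function of small norm turns a weak upper gradient into an upper
gradient. -/
theorem exists_upperGradient_of_weak {μ : Measure X} {g : X → ℝ≥0∞} {u : X → ℝ} {Ω : Set X}
    (hg : Measurable g) (h : IsWeakUpperGradientOn μ g u Ω) {ε : ℝ≥0∞} (hε : ε ≠ 0) :
    ∃ g' : X → ℝ≥0∞, Measurable g' ∧ IsUpperGradientOn g' u Ω ∧
      ∀ A : Set X, ∫⁻ x in A, g' x ∂μ ≤ ∫⁻ x in A, g x ∂μ + ε := by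
  obtain ⟨Γ, hΓ, hu⟩ := h
  obtain ⟨e, he, hes⟩ := ENNReal.exists_pos_sum_of_countable' hε ℕ
  have hex : ∀ n, ∃ ρ : X → ℝ≥0∞, Measurable ρ ∧ (∀ γ ∈ Γ, 1 ≤ curveIntegral ρ γ) ∧
      ∫⁻ x, ρ x ∂μ < e n := by
    intro n
    have h1 : Mod1 μ Γ < e n := by rw [hΓ]; exact he n
    unfold Mod1 at h1
    simp only [iInf_lt_iff] at h1
    obtain ⟨ρ, h1, h2, h3⟩ := h1
    exact ⟨ρ, h1, h2, h3⟩
  choose ρ hρm hρΓ hρ using hex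
  refine ⟨fun x => g x + ∑' n, ρ n x, hg.add (Measurable.tsum hρm), ?_, ?_⟩
  · intro γ hγ
    by_cases hmem : γ ∈ Γ
    · have : curveIntegral (fun x => g x + ∑' n, ρ n x) γ = ⊤ := by
        rw [eq_top_iff, ← ENNReal.tsum_const_eq_top_of_ne_zero (α := ℕ) one_ne_zero]
        rw [ENNReal.tsum_eq_iSup_sum]
        refine iSup_le fun s => ?_
        have : ∀ s : Finset ℕ, ∑ n ∈ s, (1 : ℝ≥0∞) ≤ curveIntegral (fun x => ∑ n ∈ s, ρ n x) γ := by
          intro s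
          induction s using Finset.induction_on with
          | empty => simp
          | insert a s ha ih =>
            rw [Finset.sum_insert ha]
            refine (add_le_add (hρΓ a γ hmem) ih).trans ?_
            unfold curveIntegral
            refine (le_lintegral_add _ _).trans (le_of_eq (lintegral_congr fun t => ?_))
            beta_reduce
            rw [Finset.sum_insert ha, add_mul]
        refine (this s).trans (curveIntegral_mono (fun x => ?_) γ)
        exact (ENNReal.sum_le_tsum s).trans le_add_self
      rw [this]; exact le_top
    · exact (hu γ hmem hγ).trans (curveIntegral_mono (fun x => le_self_add) γ)
  · intro A
    rw [lintegral_add_left hg, lintegral_tsum fun n => (hρm n).aemeasurable]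
    gcongr
    refine (ENNReal.tsum_le_tsum fun n => ?_).trans hes.le
    exact (setLIntegral_le_lintegral _ _).trans (hρ n).le

/-! ### Doubling spaces -/

section Doubling

variable {μ : Measure X} {Cd CP lam : ℝ}

theorem MMS.measure_ball_pos (h : MMS μ Cd CP lam) (x : X) {r : ℝ} (hr : 0 < r) :
    0 < μ (ball x r) := by
  have := (h.doubling x (r / 2) (by positivity)).1
  rwa [show 2 * (r / 2) = r by ring] at this

theorem MMS.measure_ball_lt_top (h : MMS μ Cd CP lam) (x : X) (r : ℝ) : μ (ball x r) < ⊤ := by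
  rcases lt_or_ge 0 r with hr | hr
  · exact (h.doubling x r hr).2.2
  · simp [ball_eq_empty.2 hr]

theorem MMS.measure_ball_two_pow (h : MMS μ Cd CP lam) (x : X) {r : ℝ} (hr : 0 < r) (k : ℕ) :
    μ (ball x (2 ^ k * r)) ≤ ENNReal.ofReal Cd ^ k * μ (ball x r) := by
  induction k with
  | zero => simp
  | succ k ih =>
    have := (h.doubling x (2 ^ k * r) (by positivity)).2.1
    rw [show (2 : ℝ) ^ (k + 1) * r = 2 * (2 ^ k * r) by ring]
    refine this.trans ?_
    rw [pow_succ', mul_assoc]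
    gcongr

theorem MMS.measure_ball_le (h : MMS μ Cd CP lam) {x y : X} {r s : ℝ} (hr : 0 < r) (k : ℕ)
    (hs : dist x y + s ≤ 2 ^ k * r) :
    μ (ball x s) ≤ ENNReal.ofReal Cd ^ k * μ (ball y r) :=
  (measure_mono (ball_subset_ball' (by linarith))).trans (h.measure_ball_two_pow y hr k)

theorem MMS.one_le_ofReal (h : MMS μ Cd CP lam) : 1 ≤ ENNReal.ofReal Cd :=
  ENNReal.one_le_ofReal.2 h.hCd

theorem MMS.isLocallyFiniteMeasure (h : MMS μ Cd CP lam) : IsLocallyFiniteMeasure μ :=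
  ⟨fun x => ⟨ball x 1, ball_mem_nhds x one_pos, h.measure_ball_lt_top x 1⟩⟩

theorem MMS.isUnifLocDoublingMeasure (h : MMS μ Cd CP lam) : IsUnifLocDoublingMeasure μ := by
  refine ⟨⟨(Real.toNNReal Cd) ^ 2, ?_⟩⟩
  filter_upwards [self_mem_nhdsWithin] with ε (hε : 0 < ε) x
  calc μ (closedBall x (2 * ε)) ≤ μ (ball x (2 ^ 2 * ε)) :=
        measure_mono (closedBall_subset_ball (by linarith))
    _ ≤ ENNReal.ofReal Cd ^ 2 * μ (ball x ε) := h.measure_ball_two_pow x hε 2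
    _ ≤ _ := by
        rw [ENNReal.coe_pow]
        exact mul_le_mul_right (measure_mono ball_subset_closedBall) _

theorem MMS.properSpace [BorelSpace X] (h : MMS μ Cd CP lam) : ProperSpace X := by
  have := h.complete
  refine ⟨fun x r => ?_⟩
  refine TotallyBounded.isCompact_of_isClosed ?_ isClosed_closedBall
  rw [Metric.totallyBounded_iff]
  intro ε hε
  obtain ⟨u, hu, hdisj, hcov⟩ := Vitali.exists_disjoint_subfamily_covering_enlargement_ball
    (closedBall x r) (fun y => y) (fun _ => ε / 5) (ε / 5) (fun _ _ => le_rfl) 5 (by norm_num)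
  refine ⟨u, ?_, fun y hy => ?_⟩
  · obtain ⟨k, hk⟩ := pow_unbounded_of_one_lt ((2 * r + 1) / (ε / 5)) (one_lt_two (α := ℝ))
    rw [div_lt_iff₀ (by positivity)] at hk
    rcases lt_or_ge r 0 with hr | hr
    · rw [closedBall_eq_empty.2 hr, subset_empty_iff] at hu
      simp [hu]
    have hlow : ∀ y ∈ u, μ (ball x (r + 1)) / ENNReal.ofReal Cd ^ k ≤ μ (ball y (ε / 5)) := by
      intro y hy
      refine ENNReal.div_le_of_le_mul' ?_
      refine h.measure_ball_le (by positivity) k ?_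
      have := mem_closedBall.1 (hu hy)
      rw [dist_comm] at this
      linarith
    have hpos : 0 < μ (ball x (r + 1)) / ENNReal.ofReal Cd ^ k :=
      ENNReal.div_pos (h.measure_ball_pos x (by linarith)).ne'
        (ENNReal.pow_ne_top ENNReal.ofReal_ne_top)
    have := Measure.finite_const_le_meas_of_disjoint_iUnion μ hpos
      (As := fun y : u => ball (y : X) (ε / 5)) (fun y => measurableSet_ball)
      (fun y z hyz => hdisj y.2 z.2 (fun h => hyz (Subtype.ext h))) ?_
    · have h2 : {y : u | μ (ball x (r + 1)) / ENNReal.ofReal Cd ^ k ≤ μ (ball (y : X) (ε / 5))}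
          = univ := eq_univ_of_forall fun y => hlow y y.2
      rw [h2, finite_univ_iff] at this
      exact toFinite u
    · refine ne_top_of_le_ne_top (h.measure_ball_lt_top x (r + ε)).ne (measure_mono ?_)
      refine iUnion_subset fun y => ball_subset_ball' ?_
      have := mem_closedBall.1 (hu y.2)
      linarith
  · obtain ⟨b, hb, hsub⟩ := hcov y hy
    refine mem_iUnion₂.2 ⟨b, hb, ?_⟩
    have := hsub (mem_ball_self (by positivity))
    rwa [show 5 * (ε / 5) = ε by ring] at this

theorem MMS.exists_disjoint_subfamily [BorelSpace X] (h : MMS μ Cd CP lam) {ι : Type*}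
    (t : Set ι) (c : ι → X) (ρ : ι → ℝ) {R : ℝ} (hpos : ∀ a ∈ t, 0 < ρ a)
    (hR : ∀ a ∈ t, ρ a ≤ R) :
    ∃ u ⊆ t, u.Countable ∧ (u.PairwiseDisjoint fun a => ball (c a) (ρ a)) ∧
      ∀ a ∈ t, ∃ b ∈ u, ball (c a) (ρ a) ⊆ ball (c b) (5 * ρ b) := by
  have := h.properSpace
  obtain ⟨u, hu, hdisj, hcov⟩ := Vitali.exists_disjoint_subfamily_covering_enlargement_ball
    t c ρ R hR 5 (by norm_num)
  exact ⟨u, hu, hdisj.countable_of_isOpen (fun _ _ => isOpen_ball)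
    (fun a ha => nonempty_ball.2 (hpos a (hu ha))), hdisj, hcov⟩

/-- Almost every point of `E` is the centre of arbitrarily small balls in which `E` has density
bounded away from zero. -/
theorem MMS.ae_exists_density [BorelSpace X] (h : MMS μ Cd CP lam) (E : Set X) :
    ∀ᵐ y ∂μ.restrict E, ∀ δ : ℝ, 0 < δ → ∃ ρ, 0 < ρ ∧ ρ < δ ∧
      μ (ball y ρ) ≤ 2 * ENNReal.ofReal Cd * μ (E ∩ ball y ρ) := by
  have := h.properSpace
  have := h.isLocallyFiniteMeasure
  have := h.isUnifLocDoublingMeasure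
  filter_upwards [IsUnifLocDoublingMeasure.ae_tendsto_measure_inter_div μ E 1] with y hy δ hδ
  have h1 := hy (fun _ : ℝ => y) (fun s : ℝ => s) (l := 𝓝[>] 0) tendsto_id
    (by filter_upwards [self_mem_nhdsWithin] with s (hs : 0 < s)
        exact mem_closedBall_self (by linarith))
  have h2 := h1.eventually (lt_mem_nhds (show (2 : ℝ≥0∞)⁻¹ < 1 by norm_num))
  obtain ⟨s, hs, hs0, hsδ⟩ := (h2.and (Ioo_mem_nhdsGT (show 0 < δ / 2 by positivity))).exists
  refine ⟨2 * s, by positivity, by linarith, ?_⟩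
  have hpos : μ (closedBall y s) ≠ 0 :=
    ((h.measure_ball_pos y hs0).trans_le (measure_mono ball_subset_closedBall)).ne'
  have hfin : μ (closedBall y s) ≠ ⊤ :=
    ((measure_mono (closedBall_subset_ball (by linarith))).trans_lt
      (h.measure_ball_lt_top y (2 * s))).ne
  rw [ENNReal.lt_div_iff_mul_lt (Or.inl hpos) (Or.inl hfin)] at hs
  have h3 : μ (closedBall y s) ≤ 2 * μ (E ∩ closedBall y s) := by
    calc μ (closedBall y s) = 2 * (2⁻¹ * μ (closedBall y s)) := by
          rw [← mul_assoc, ENNReal.mul_inv_cancel (by norm_num) (by norm_num), one_mul]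
      _ ≤ _ := by gcongr
  calc μ (ball y (2 * s)) ≤ ENNReal.ofReal Cd * μ (ball y s) := (h.doubling y s hs0).2.1
    _ ≤ ENNReal.ofReal Cd * (2 * μ (E ∩ ball y (2 * s))) := by
        gcongr
        refine (measure_mono ball_subset_closedBall).trans (h3.trans ?_)
        gcongr
        exact closedBall_subset_ball (by linarith)
    _ = _ := by ring

/-- The set `E` occupies in `B(y, t)` at least the fraction `1/Q` and at most one half. -/
def IsTransition (μ : Measure X) (E : Set X) (Q : ℝ≥0∞) (y : X) (t : ℝ) : Prop :=
  μ (ball y t) ≤ Q * μ (E ∩ ball y t) ∧ 2 * μ (E ∩ ball y t) ≤ μ (ball y t)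

theorem MMS.exists_isTransition (h : MMS μ Cd CP lam) {E : Set X} {Q : ℝ≥0∞}
    (hQ : 2 * ENNReal.ofReal Cd ≤ Q) {y : X} {ρ t₀ : ℝ} (hρ : 0 < ρ) (hρt : ρ < t₀)
    (hden : μ (ball y ρ) ≤ Q * μ (E ∩ ball y ρ))
    (hsmall : ∀ t, t₀ ≤ t → 2 * μ (E ∩ ball y t) ≤ μ (ball y t)) :
    ∃ t, 0 < t ∧ t < 2 * t₀ ∧ IsTransition μ E Q y t := by
  have hex : ∃ k : ℕ, 2 * μ (E ∩ ball y (2 ^ k * ρ)) ≤ μ (ball y (2 ^ k * ρ)) := by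
    obtain ⟨k, hk⟩ := pow_unbounded_of_one_lt (t₀ / ρ) (one_lt_two (α := ℝ))
    rw [div_lt_iff₀ hρ] at hk
    exact ⟨k, hsmall _ hk.le⟩
  classical
  have hk := Nat.find_spec hex
  have hmin := fun m => Nat.find_min hex (m := m)
  generalize Nat.find hex = k at hk hmin
  refine ⟨2 ^ k * ρ, by positivity, ?_, ?_, hk⟩
  · rcases k with _ | k
    · simp; linarith
    · by_contra hcon
      refine hmin k (Nat.lt_succ_self k) (hsmall _ ?_)
      rw [pow_succ] at hcon
      linarith
  · rcases k with _ | k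
    · simpa using hden
    · have h1 := hmin k (Nat.lt_succ_self k)
      rw [not_le] at h1
      have h2 := (h.doubling y (2 ^ k * ρ) (by positivity)).2.1
      rw [show (2 : ℝ) ^ (k + 1) * ρ = 2 * (2 ^ k * ρ) by ring]
      calc _ ≤ _ := h2
        _ ≤ ENNReal.ofReal Cd * (2 * μ (E ∩ ball y (2 * (2 ^ k * ρ)))) := by
            refine mul_le_mul_right (h1.le.trans ?_) _
            have : 0 < 2 ^ k * ρ := by positivity
            exact mul_le_mul_right (measure_mono (inter_subset_inter_right _
              (ball_subset_ball (by linarith)))) _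
        _ = 2 * ENNReal.ofReal Cd * μ (E ∩ ball y (2 * (2 ^ k * ρ))) := by ring
        _ ≤ _ := by gcongr

end Doubling

/-! ### Consequences of the Poincaré inequality -/

section Poincare

omit [MeasurableSpace X] in
theorem curveIntegral_top_of_ne_zero {f g : X → ℝ≥0∞} {γ : Curve X} (hf : curveIntegral f γ ≠ 0)
    (hg : ∀ x, f x ≠ 0 → g x = ⊤) : curveIntegral g γ = ⊤ := by
  have hn : ∀ n : ℕ, (n : ℝ≥0∞) * curveIntegral f γ ≤ curveIntegral g γ := by
    intro n
    have : (n : ℝ≥0∞) * curveIntegral f γ = curveIntegral (fun x => n * f x) γ := by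
      unfold curveIntegral
      rw [← lintegral_const_mul' _ _ (ENNReal.natCast_ne_top n)]
      refine lintegral_congr fun t => ?_
      ring
    rw [this]
    refine curveIntegral_mono (fun x => ?_) γ
    by_cases hx : f x = 0
    · simp [hx]
    · rw [hg x hx]; exact le_top
  by_contra htop
  obtain ⟨n, hn'⟩ := ENNReal.exists_nat_mul_gt hf htop
  exact absurd (hn n) (not_le.2 hn')

omit [MeasurableSpace X] in
open Classical in
theorem IsUpperGradientOn.extend {g : X → ℝ≥0∞} {v : X → ℝ} {Ω : Set X}
    (hg : IsUpperGradientOn g v Ω) {y : X} {s R : ℝ} (hsR : s < R) (hK : closedBall y R ⊆ Ω) :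
    IsUpperGradientOn (fun x => if x ∈ ball y s then g x else ⊤) ((closedBall y R).indicator v)
      univ := by
  intro γ _
  set g' : X → ℝ≥0∞ := fun x => if x ∈ ball y s then g x else ⊤ with hg'
  have hle : ∀ x, g x ≤ g' x := by
    intro x
    simp only [hg']
    split_ifs
    · exact le_rfl
    · exact le_top
  have key : ∀ a b : ℝ, 0 ≤ a → a < b → b ≤ 1 →
      ¬ (γ.toFun a ∈ closedBall y R ↔ γ.toFun b ∈ closedBall y R) → curveIntegral g' γ = ⊤ := by
    intro a b ha hab hb hne
    refine eq_top_iff.2 (le_trans (le_of_eq ?_) (curveIntegral_sub_le g' γ ha hab hb))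
    symm
    refine curveIntegral_top_of_ne_zero
      (f := {x | s < dist x y}.indicator fun _ => ENNReal.ofReal 1) ?_ ?_
    · have h1 := lipschitz_le_curveIntegral (φ := fun x => max (dist x y) s) (L := 1) zero_le_one
        (fun x z => by
          rw [one_mul]
          exact (abs_max_sub_max_le_abs _ _ _).trans (abs_dist_sub_le _ _ _))
        (A := {x | s < dist x y})
        (fun x hx => by
          left
          intro z
          rw [mem_ofPred_eq, not_lt] at hx
          rw [max_eq_right hx]
          exact le_max_right _ _) (γ.sub ha hab hb)
      refine ne_of_gt (lt_of_lt_of_le ?_ h1)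
      rw [ENNReal.ofReal_pos, abs_pos, sub_ne_zero]
      simp only [Curve.sub, mul_one, mul_zero, add_zero, add_sub_cancel]
      intro heq
      apply hne
      have hm : ∀ x, x ∈ closedBall y R ↔ max (dist x y) s ≤ R := by
        intro x
        rw [mem_closedBall, max_le_iff, and_iff_left hsR.le]
      rw [hm, hm, heq]
    · intro x hx
      have : x ∈ {x | s < dist x y} := by
        by_contra hcon
        exact hx (indicator_of_notMem hcon _)
      have h2 : x ∉ ball y s := by
        rw [mem_ball, not_lt]; exact (le_of_lt this)
      exact if_neg h2
  by_cases hall : ∀ t ∈ Icc (0 : ℝ) 1, γ.toFun t ∈ closedBall y R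
  · rw [indicator_of_mem (hall 1 (by simp)), indicator_of_mem (hall 0 (by simp))]
    exact (hg γ fun t ht => hK (hall t ht)).trans (curveIntegral_mono hle γ)
  · push Not at hall
    obtain ⟨t, ht, htK⟩ := hall
    by_cases h0 : γ.toFun 0 ∈ closedBall y R
    · rw [key 0 t le_rfl (lt_of_le_of_ne ht.1 (by rintro rfl; exact htK h0)) ht.2 (by tauto)]
      exact le_top
    · by_cases h1 : γ.toFun 1 ∈ closedBall y R
      · rw [key t 1 ht.1 (lt_of_le_of_ne ht.2 (by rintro rfl; exact htK h1)) le_rfl (by tauto)]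
        exact le_top
      · rw [indicator_of_notMem h0, indicator_of_notMem h1]
        simp

variable {μ : Measure X} {Cd CP lam : ℝ}

omit [MetricSpace X] in
theorem measure_le_lintegral_chi_sub {E B : Set X} (hE : MeasurableSet E) {m : ℝ≥0∞}
    (h1 : m ≤ μ (E ∩ B)) (h2 : m ≤ μ (B \ E)) (c : ℝ) :
    m ≤ ∫⁻ z in B, ENNReal.ofReal |chi E z - c| ∂μ := by
  rw [← lintegral_inter_add_sdiff _ B hE]
  have e1 : ∫⁻ z in B ∩ E, ENNReal.ofReal |chi E z - c| ∂μ = ENNReal.ofReal |1 - c| * μ (E ∩ B) := by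
    rw [inter_comm E B, ← setLIntegral_const]
    have : (fun z => ENNReal.ofReal |chi E z - c|) =ᵐ[μ.restrict (B ∩ E)]
        fun _ => ENNReal.ofReal |1 - c| := by
      have h3 : ∀ᵐ z ∂(μ.restrict B).restrict E, z ∈ E := ae_restrict_mem hE
      rw [Measure.restrict_restrict hE, inter_comm] at h3
      filter_upwards [h3] with z hz
      simp [chi, hz]
    exact lintegral_congr_ae this
  have e2 : ∫⁻ z in B \ E, ENNReal.ofReal |chi E z - c| ∂μ = ENNReal.ofReal |c| * μ (B \ E) := by
    rw [← setLIntegral_const]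
    have : (fun z => ENNReal.ofReal |chi E z - c|) =ᵐ[μ.restrict (B \ E)]
        fun _ => ENNReal.ofReal |c| := by
      have h3 : ∀ᵐ z ∂(μ.restrict B).restrict Eᶜ, z ∈ Eᶜ := ae_restrict_mem hE.compl
      rw [Measure.restrict_restrict hE.compl, inter_comm, ← sdiff_eq] at h3
      filter_upwards [h3] with z hz
      have : z ∉ E := hz
      simp [chi, this]
    exact lintegral_congr_ae this
  rw [e1, e2]
  calc m = 1 * m := (one_mul _).symm
    _ ≤ (ENNReal.ofReal |1 - c| + ENNReal.ofReal |c|) * m := by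
        gcongr
        rw [← ENNReal.ofReal_add (abs_nonneg _) (abs_nonneg _), ENNReal.one_le_ofReal]
        have := abs_add_le (1 - c) c
        simpa using this
    _ ≤ _ := by
        rw [add_mul]
        gcongr

theorem MMS.measure_ball_le_of_isTransition [BorelSpace X] (h : MMS μ Cd CP lam) {E Ω : Set X}
    (hE : MeasurableSet E) {v : X → ℝ} {g : X → ℝ≥0∞} (hv : LocLipschitzOn v Ω)
    (hgm : Measurable g) (hg : IsUpperGradientOn g v Ω) {y : X} {t R : ℝ} (ht : 0 < t)
    (hR : lam * t < R) (hK : closedBall y R ⊆ Ω) {Q : ℝ≥0∞} (hQ : 2 ≤ Q) (hQt : Q ≠ ⊤)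
    (htr : IsTransition μ E Q y t) :
    μ (ball y t) ≤ Q * (∫⁻ z in ball y t, ENNReal.ofReal |v z - chi E z| ∂μ +
      ENNReal.ofReal (CP * t) * ∫⁻ z in ball y (lam * t), g z ∂μ) := by
  classical
  have := h.properSpace
  have := h.isLocallyFiniteMeasure
  set B := ball y t with hB
  have htR : t ≤ R := by nlinarith [h.hlam]
  have hBK : B ⊆ closedBall y R := ball_subset_closedBall.trans (closedBall_subset_closedBall htR)
  set u : X → ℝ := (closedBall y R).indicator v with hu
  obtain ⟨L, hL⟩ := hv _ (isCompact_closedBall y R) hK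
  have huint : Integrable u μ := by
    rw [hu, integrable_indicator_iff measurableSet_closedBall]
    exact hL.continuousOn.integrableOn_compact (isCompact_closedBall y R)
  have hpoin := h.poincare y t ht u huint.locallyIntegrable
    (fun x => if x ∈ ball y (lam * t) then g x else ⊤)
    (Measurable.ite measurableSet_ball hgm measurable_const) (hg.extend hR hK)
  set c := ⨍ z in B, u z ∂μ
  have hchi : Measurable (chi E) := measurable_const.indicator hE
  have htri : ∫⁻ z in B, ENNReal.ofReal |chi E z - c| ∂μ ≤
      ∫⁻ z in B, ENNReal.ofReal |u z - chi E z| ∂μ + ∫⁻ z in B, ENNReal.ofReal |u z - c| ∂μ := by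
    rw [← lintegral_add_left']
    · refine lintegral_mono fun z => ?_
      rw [← ENNReal.ofReal_add (abs_nonneg _) (abs_nonneg _)]
      refine ENNReal.ofReal_le_ofReal ?_
      rw [abs_sub_comm (u z)]
      exact abs_sub_le _ _ _
    · refine AEMeasurable.ennreal_ofReal ?_
      have : AEMeasurable (fun z => u z - chi E z) (μ.restrict B) :=
        (huint.aestronglyMeasurable.aemeasurable.restrict).sub hchi.aemeasurable
      simpa only [Real.norm_eq_abs] using this.norm
  have heq1 : ∫⁻ z in B, ENNReal.ofReal |u z - chi E z| ∂μ =
      ∫⁻ z in B, ENNReal.ofReal |v z - chi E z| ∂μ :=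
    setLIntegral_congr_fun measurableSet_ball fun z hz => by
      simp only [hu, indicator_of_mem (hBK hz)]
  have heq2 : ∫⁻ z in ball y (lam * t), (if z ∈ ball y (lam * t) then g z else ⊤) ∂μ =
      ∫⁻ z in ball y (lam * t), g z ∂μ :=
    setLIntegral_congr_fun measurableSet_ball fun z hz => if_pos hz
  rw [heq2] at hpoin
  have hfrac : μ B / μ (ball y (lam * t)) ≤ 1 := by
    refine ENNReal.div_le_of_le_mul ?_
    rw [one_mul]
    exact measure_mono (ball_subset_ball (by nlinarith [h.hlam]))
  have hpoin' : ∫⁻ z in B, ENNReal.ofReal |u z - c| ∂μ ≤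
      ENNReal.ofReal (CP * t) * ∫⁻ z in ball y (lam * t), g z ∂μ := by
    refine hpoin.trans ?_
    gcongr
    exact mul_le_of_le_one_right' hfrac
  have hQ0 : Q ≠ 0 := (lt_of_lt_of_le (by norm_num) hQ).ne'
  have hm1 : μ B / Q ≤ μ (E ∩ B) := ENNReal.div_le_of_le_mul' htr.1
  have hm2 : μ B / Q ≤ μ (B \ E) := by
    refine ENNReal.div_le_of_le_mul' (le_trans ?_ (mul_le_mul_left hQ _))
    have h4 := measure_inter_add_sdiff (μ := μ) B hE
    have h5 := htr.2
    rw [← hB, ← h4, inter_comm, two_mul] at h5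
    have hfin : μ (B ∩ E) ≠ ⊤ :=
      ((measure_mono inter_subset_left).trans_lt (h.measure_ball_lt_top y t)).ne
    have h6 := (ENNReal.add_le_add_iff_left hfin).1 h5
    rw [← h4, two_mul]
    gcongr
  rw [mul_comm, ← ENNReal.div_le_iff_le_mul (Or.inl hQ0) (Or.inl hQt)]
  refine (measure_le_lintegral_chi_sub hE hm1 hm2 c).trans (htri.trans ?_)
  rw [heq1]
  gcongr

end Poincare

/-! ### Approximating sequences and lower semicontinuity of the perimeter -/

section Approximation

variable {μ : Measure X} {Cd CP lam : ℝ}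

theorem mod1_empty (μ : Measure X) : Mod1 μ ∅ = 0 := by
  refine le_antisymm (iInf₂_le_of_le 0 measurable_zero ?_) (zero_le)
  exact iInf_le_of_le (fun γ hγ => absurd hγ (notMem_empty γ)) (by simp)

theorem IsUpperGradientOn.isWeak {g : X → ℝ≥0∞} {u : X → ℝ} {Ω : Set X}
    (h : IsUpperGradientOn g u Ω) : IsWeakUpperGradientOn μ g u Ω :=
  ⟨∅, mod1_empty μ, fun γ _ hγ => h γ hγ⟩

/-- A sequence of locally Lipschitz functions converging to `chi E` in `L¹_loc(Ω)`, with upper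
gradients whose integrals over `Ω` are at most `M`. -/
structure IsApprox (μ : Measure X) (E Ω : Set X) (M : ℝ≥0∞) (v : ℕ → X → ℝ)
    (g : ℕ → X → ℝ≥0∞) : Prop where
  lip : ∀ i, LocLipschitzOn (v i) Ω
  tendsto : TendstoL1Loc μ v (chi E) Ω
  meas : ∀ i, Measurable (g i)
  ug : ∀ i, IsUpperGradientOn (g i) (v i) Ω
  le : ∀ i, ∫⁻ x in Ω, g i x ∂μ ≤ M

theorem exists_isApprox {E Ω : Set X} {M : ℝ≥0∞} (hM : perim μ E Ω < M) :
    ∃ v g, IsApprox μ E Ω M v g := by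
  obtain ⟨M', hM', hM'M⟩ := exists_between hM
  unfold perim tv at hM'
  simp only [iInf_lt_iff] at hM'
  obtain ⟨v, hv, hvE, g, hgm, hg, hlim⟩ := hM'
  obtain ⟨φ, hφ, hφM⟩ := extraction_of_frequently_atTop (frequently_lt_of_liminf_lt
    (by isBoundedDefault) hlim)
  choose g' hg'm hg' hle using fun i =>
    exists_upperGradient_of_weak (hgm i) (hg i) (tsub_pos_of_lt hM'M).ne'
  refine ⟨fun i => v (φ i), fun i => g' (φ i), fun i => hv _, fun K hK hKΩ =>
    (hvE K hK hKΩ).comp hφ.tendsto_atTop, fun i => hg'm _, fun i => hg' _, fun i => ?_⟩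
  calc ∫⁻ x in Ω, g' (φ i) x ∂μ ≤ ∫⁻ x in Ω, g (φ i) x ∂μ + (M - M') := hle _ _
    _ ≤ M' + (M - M') := by gcongr; exact (hφM i).le
    _ = M := add_tsub_cancel_of_le hM'M.le

theorem IsApprox.eventually_measure_ball_le [BorelSpace X] (h : MMS μ Cd CP lam) {E Ω : Set X}
    (hE : MeasurableSet E) {M : ℝ≥0∞} {v : ℕ → X → ℝ} {g : ℕ → X → ℝ≥0∞}
    (hv : IsApprox μ E Ω M v g) {y : X} {t R : ℝ} (ht : 0 < t)
    (hR : lam * t < R) (hK : closedBall y R ⊆ Ω) {Q : ℝ≥0∞} (hQ : 2 ≤ Q) (hQt : Q ≠ ⊤)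
    (htr : IsTransition μ E Q y t) :
    ∀ᶠ i in atTop, μ (ball y t) ≤
      2 * Q * ENNReal.ofReal (CP * t) * ∫⁻ z in ball y (lam * t), g i z ∂μ := by
  have := h.properSpace
  have hQ0 : Q ≠ 0 := (lt_of_lt_of_le (by norm_num) hQ).ne'
  have hB0 := h.measure_ball_pos y ht
  have hBt := (h.measure_ball_lt_top y t).ne
  have htR : t ≤ R := by nlinarith [h.hlam]
  have hBK : ball y t ⊆ closedBall y R :=
    ball_subset_closedBall.trans (closedBall_subset_closedBall htR)
  have hpos : 0 < μ (ball y t) / 2 / Q :=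
    ENNReal.div_pos (ENNReal.div_pos hB0.ne' (by norm_num)).ne' hQt
  filter_upwards [(hv.tendsto _ (isCompact_closedBall y R) hK).eventually_lt_const hpos] with i hi
  have key := h.measure_ball_le_of_isTransition hE (hv.lip i) (hv.meas i) (hv.ug i) ht hR hK hQ
    hQt htr
  have h1 : Q * ∫⁻ z in ball y t, ENNReal.ofReal |v i z - chi E z| ∂μ ≤ μ (ball y t) / 2 := by
    calc _ ≤ Q * (μ (ball y t) / 2 / Q) := by
          gcongr
          exact (lintegral_mono_set hBK).trans hi.le
      _ ≤ _ := ENNReal.mul_div_le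
  set Y := ENNReal.ofReal (CP * t) * ∫⁻ z in ball y (lam * t), g i z ∂μ with hY
  rw [mul_add] at key
  have h2 : μ (ball y t) / 2 + μ (ball y t) / 2 ≤ μ (ball y t) / 2 + Q * Y := by
    rw [ENNReal.add_halves]
    exact key.trans (by gcongr)
  have h3 := (ENNReal.add_le_add_iff_left (ENNReal.div_ne_top hBt (by norm_num))).1 h2
  calc μ (ball y t) = μ (ball y t) / 2 + μ (ball y t) / 2 := (ENNReal.add_halves _).symm
    _ ≤ Q * Y + Q * Y := by gcongr
    _ = _ := by rw [hY]; ring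

theorem exists_compact_perim_le [BorelSpace X] (h : MMS μ Cd CP lam) {E : Set X} {x : X} {R : ℝ}
    (hP : perim μ E (ball x R) ≠ ⊤) {η : ℝ≥0∞} (hη : η ≠ 0) :
    ∃ K ⊆ ball x R, IsCompact K ∧ ∃ δ : ℝ≥0∞, δ ≠ 0 ∧ ∀ (w : X → ℝ) (g : X → ℝ≥0∞),
      LocLipschitzOn w (ball x R) → Measurable g → IsUpperGradientOn g w (ball x R) →
      ∫⁻ z in K, ENNReal.ofReal |w z - chi E z| ∂μ < δ →
      perim μ E (ball x R) ≤ ∫⁻ z in ball x R, g z ∂μ + η := by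
  have := h.properSpace
  by_contra! hcon
  have hsub : ∀ n : ℕ, closedBall x (R - 1 / ((n : ℝ) + 1)) ⊆ ball x R := fun n =>
    closedBall_subset_ball (by linarith [Nat.one_div_pos_of_nat (α := ℝ) (n := n)])
  choose w g hw hgm hg hlt hP' using fun n : ℕ =>
    hcon (closedBall x (R - 1 / ((n : ℝ) + 1))) (hsub n) (isCompact_closedBall _ _)
      ((n : ℝ≥0∞) + 1)⁻¹ (by simp)
  have hconv : TendstoL1Loc μ w (chi E) (ball x R) := by
    intro K hK hKR
    obtain ⟨R', hR', hKR'⟩ := exists_lt_subset_ball hK.isClosed hKR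
    have hev : ∀ᶠ n : ℕ in atTop, K ⊆ closedBall x (R - 1 / ((n : ℝ) + 1)) := by
      filter_upwards [(tendsto_one_div_add_atTop_nhds_zero_nat (𝕜 := ℝ)).eventually_lt_const
        (sub_pos.2 hR')] with n hn
      exact hKR'.trans (ball_subset_closedBall.trans (closedBall_subset_closedBall (by linarith)))
    have hlim : Tendsto (fun n : ℕ => ((n : ℝ≥0∞) + 1)⁻¹) atTop (𝓝 0) := by
      have := (tendsto_add_atTop_iff_nat 1).2 ENNReal.tendsto_inv_nat_nhds_zero
      simpa using this
    refine tendsto_of_tendsto_of_tendsto_of_le_of_le' tendsto_const_nhds hlim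
      (Eventually.of_forall fun _ => zero_le) ?_
    filter_upwards [hev] with n hn
    exact (lintegral_mono_set hn).trans (hlt n).le
  have h1 : perim μ E (ball x R) ≤ liminf (fun i => ∫⁻ z in ball x R, g i z ∂μ) atTop :=
    iInf₂_le_of_le w hw <| iInf₂_le_of_le hconv g <| iInf₂_le_of_le hgm
      (fun i => (hg i).isWeak) le_rfl
  have h2 : ∀ n, ∫⁻ z in ball x R, g n z ∂μ ≤ perim μ E (ball x R) - η := fun n =>
    ENNReal.le_sub_of_add_le_right (ne_top_of_le_ne_top hP (le_add_self.trans (hP' n).le)) (hP' n).le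
  have h3 : perim μ E (ball x R) ≤ perim μ E (ball x R) - η :=
    h1.trans (liminf_le_of_le (by isBoundedDefault) fun b hb =>
      let ⟨n, hn⟩ := hb.exists
      hn.trans (h2 n))
  have h0 : perim μ E (ball x R) ≠ 0 := (zero_le.trans_lt (hP' 0)).ne'
  exact absurd h3 (not_le.2 (ENNReal.sub_lt_self hP h0 hη))

end Approximation

/-! ### Coverings by balls in which the set has intermediate density -/

section Covering

variable {μ : Measure X} {Cd CP lam : ℝ}

theorem IsTransition.of_inter {E W : Set X} {Q : ℝ≥0∞} {y : X} {t : ℝ}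
    (h : IsTransition μ (E ∩ W) Q y t) (hW : ball y t ⊆ W) : IsTransition μ E Q y t := by
  have : E ∩ W ∩ ball y t = E ∩ ball y t := by
    rw [inter_assoc, inter_eq_right.2 hW]
  rwa [IsTransition, this] at h

theorem MMS.exists_transition_cover [BorelSpace X] (h : MMS μ Cd CP lam) {E Ω U S : Set X}
    (hE : MeasurableSet E) {t : X → ℝ} {T : ℝ} {Q : ℝ≥0∞} (hQ : 2 ≤ Q) (hQt : Q ≠ ⊤)
    (hpos : ∀ y ∈ S, 0 < t y) (hT : ∀ y ∈ S, t y ≤ T) (hU : ∀ y ∈ S, ball y (lam * t y) ⊆ U)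
    (hΩ : ∀ y ∈ S, closedBall y (2 * lam * t y) ⊆ Ω) (htr : ∀ y ∈ S, IsTransition μ E Q y (t y))
    {n : ℕ} (hn : 5 * lam ≤ 2 ^ n) :
    ∃ u ⊆ S, u.Countable ∧ S ⊆ ⋃ y ∈ u, ball y (5 * lam * t y) ∧
      ∀ M v g, IsApprox μ E Ω M v g → ∀ F : Finset X, ↑F ⊆ u → ∀ᶠ i in atTop,
        ∑ y ∈ F, μ (ball y (5 * lam * t y)) / ENNReal.ofReal (t y) ≤
          2 * Q * ENNReal.ofReal Cd ^ n * ENNReal.ofReal CP * ∫⁻ z in U, g i z ∂μ := by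
  have hl : 0 < lam := lt_of_lt_of_le one_pos h.hlam
  obtain ⟨u, huS, huc, hdisj, hcov⟩ := h.exists_disjoint_subfamily S id (fun y => lam * t y)
    (R := lam * T) (fun y hy => mul_pos hl (hpos y hy))
    (fun y hy => mul_le_mul_of_nonneg_left (hT y hy) hl.le)
  refine ⟨u, huS, huc, fun y hy => ?_, fun M v g hv F hF => ?_⟩
  · obtain ⟨b, hb, hyb⟩ := hcov y hy
    refine mem_iUnion₂.2 ⟨b, hb, ?_⟩
    have := hyb (mem_ball_self (mul_pos hl (hpos y hy)))
    rwa [← mul_assoc] at this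
  · have hev : ∀ y ∈ F, ∀ᶠ i in atTop, μ (ball y (t y)) ≤
        2 * Q * ENNReal.ofReal (CP * t y) * ∫⁻ z in ball y (lam * t y), g i z ∂μ := fun y hy =>
      hv.eventually_measure_ball_le h hE (hpos y (huS (hF hy)))
        (by nlinarith [mul_pos hl (hpos y (huS (hF hy)))]) (hΩ y (huS (hF hy))) hQ hQt
        (htr y (huS (hF hy)))
    filter_upwards [(Filter.eventually_all_finset F).2 hev] with i hi
    calc ∑ y ∈ F, μ (ball y (5 * lam * t y)) / ENNReal.ofReal (t y)
        ≤ ∑ y ∈ F, 2 * Q * ENNReal.ofReal Cd ^ n * ENNReal.ofReal CP *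
          ∫⁻ z in ball y (lam * t y), g i z ∂μ := by
          refine Finset.sum_le_sum fun y hy => ?_
          have hty := hpos y (huS (hF hy))
          refine ENNReal.div_le_of_le_mul ?_
          calc μ (ball y (5 * lam * t y)) ≤ ENNReal.ofReal Cd ^ n * μ (ball y (t y)) :=
                h.measure_ball_le hty n (by rw [dist_self, zero_add]; gcongr)
            _ ≤ ENNReal.ofReal Cd ^ n * (2 * Q * ENNReal.ofReal (CP * t y) *
                  ∫⁻ z in ball y (lam * t y), g i z ∂μ) := by gcongr; exact hi y hy
            _ = _ := by rw [ENNReal.ofReal_mul h.hCP.le]; ring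
      _ = 2 * Q * ENNReal.ofReal Cd ^ n * ENNReal.ofReal CP *
            ∑ y ∈ F, ∫⁻ z in ball y (lam * t y), g i z ∂μ := by rw [Finset.mul_sum]
      _ = 2 * Q * ENNReal.ofReal Cd ^ n * ENNReal.ofReal CP *
            ∫⁻ z in ⋃ y ∈ F, ball y (lam * t y), g i z ∂μ := by
          rw [lintegral_biUnion_finset (t := fun y => ball y (lam * t y)) (hdisj.subset hF)
            fun y _ => measurableSet_ball]
      _ ≤ _ := by
          gcongr
          exact iUnion₂_subset fun y hy => hU y (huS (hF hy))

theorem exists_finset_lt_sum {ι : Type*} {f : ι → ℝ≥0∞} {u : Set ι} {a : ℝ≥0∞}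
    (h : a < ∑' i : u, f i) : ∃ F : Finset ι, ↑F ⊆ u ∧ a < ∑ i ∈ F, f i := by
  classical
  rw [ENNReal.tsum_eq_iSup_sum, lt_iSup_iff] at h
  obtain ⟨F, hF⟩ := h
  refine ⟨F.map (Function.Embedding.subtype _), ?_, by simpa using hF⟩
  intro i hi
  simp only [Finset.coe_map, Function.Embedding.subtype_apply] at hi
  obtain ⟨j, _, rfl⟩ := hi
  exact j.2

theorem IsApprox.eventually_gain [BorelSpace X] (h : MMS μ Cd CP lam) {E Ω : Set X}
    (hE : MeasurableSet E) {M : ℝ≥0∞} {v : ℕ → X → ℝ} {g : ℕ → X → ℝ≥0∞}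
    (hv : IsApprox μ E Ω M v g) {n k : ℕ} (hn : 5 * lam ≤ 2 ^ n) (hk : 32 * lam ≤ 2 ^ k)
    (hk' : 1024 * Cd ^ (n + 3) * CP ≤ 2 ^ k) {z : X} {ρ : ℝ} (hρ : 0 < ρ)
    (hΩ : ball z (4 * ρ) ⊆ Ω) {θ : ℝ≥0∞} (hθ : 4 * ENNReal.ofReal Cd ^ k * θ ≤ 1) (hθ0 : θ ≠ 0)
    (h4 : μ (E ∩ ball z (4 * ρ)) ≤ 2 * θ * μ (ball z (4 * ρ)))
    (h1 : θ * μ (ball z ρ) ≤ 2 * μ (E ∩ ball z ρ)) :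
    ∀ᶠ i in atTop, 2 * μ (E ∩ ball z (4 * ρ)) ≤
      ENNReal.ofReal ρ * ∫⁻ y in ball z (2 * ρ), g i y ∂μ := by
  set D := ENNReal.ofReal Cd with hD
  have hl : 0 < lam := lt_of_lt_of_le one_pos h.hlam
  have h2k : (0 : ℝ) < 2 ^ k := by positivity
  set κ : ℝ := 8 / 2 ^ k with hκ
  have hκ0 : 0 < κ := by positivity
  have hκl : 4 * lam * κ ≤ 1 := by
    rw [hκ, mul_div_assoc', div_le_one h2k]; linarith
  have hκ1 : κ ≤ 1 / 4 := by nlinarith [h.hlam]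
  have hκC : 128 * κ * (Cd ^ (n + 3) * CP) ≤ 1 := by
    rw [hκ, mul_div_assoc', div_mul_eq_mul_div, div_le_one h2k]; linarith
  have hD1 : 1 ≤ D := h.one_le_ofReal
  have hDt : D ≠ ⊤ := ENNReal.ofReal_ne_top
  set E' := E ∩ ball z (4 * ρ) with hE'
  -- transition radii
  have hsmall : ∀ y ∈ ball z ρ, ∀ t, κ * ρ ≤ t → 2 * μ (E' ∩ ball y t) ≤ μ (ball y t) := by
    intro y hy t ht
    calc 2 * μ (E' ∩ ball y t) ≤ 2 * (2 * θ * μ (ball z (4 * ρ))) := by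
          gcongr; exact (measure_mono inter_subset_left).trans h4
      _ ≤ 2 * (2 * θ * (D ^ k * μ (ball y (κ * ρ)))) := by
          gcongr
          refine h.measure_ball_le (by positivity) k ?_
          have e : 2 ^ k * (κ * ρ) = 8 * ρ := by rw [hκ]; field_simp
          rw [e, dist_comm]
          linarith [mem_ball.1 hy]
      _ = 4 * D ^ k * θ * μ (ball y (κ * ρ)) := by ring
      _ ≤ 1 * μ (ball y t) := by gcongr
      _ = μ (ball y t) := one_mul _
  have hsub : ∀ y ∈ ball z ρ, ∀ s, s ≤ ρ → ball y s ⊆ ball z (2 * ρ) := fun y hy s hs =>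
    ball_subset_ball' (by linarith [mem_ball.1 hy])
  set S : Set X := {y | y ∈ ball z ρ ∧ ∃ t, 0 < t ∧ t < 2 * (κ * ρ) ∧ IsTransition μ E (2 * D) y t}
    with hS
  have hae : μ (E ∩ ball z ρ) ≤ μ S := by
    have hden := h.ae_exists_density E'
    have : ∀ᵐ y ∂μ.restrict (E ∩ ball z ρ), y ∈ S := by
      have hsub' : E ∩ ball z ρ ⊆ E' := inter_subset_inter_right _ (ball_subset_ball (by linarith))
      filter_upwards [ae_mono (Measure.restrict_mono hsub' le_rfl) hden,
        ae_restrict_mem (hE.inter measurableSet_ball)] with y hy hymem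
      refine ⟨hymem.2, ?_⟩
      obtain ⟨s, hs0, hs, hsd⟩ := hy (κ * ρ) (by positivity)
      obtain ⟨t, ht0, ht, htt⟩ := h.exists_isTransition le_rfl hs0 hs hsd (hsmall y hymem.2)
      refine ⟨t, ht0, ht, htt.of_inter ((hsub y hymem.2 t ?_).trans (ball_subset_ball ?_))⟩
      · nlinarith
      · linarith
    have hnull := (ae_restrict_iff' (hE.inter measurableSet_ball)).1 this
    exact measure_mono_ae hnull
  choose! t ht using fun y (hy : y ∈ S) => hy.2
  have htl : ∀ y ∈ S, 2 * lam * t y ≤ ρ := by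
    intro y hy
    have := (ht y hy).2.1
    have h5 : 2 * lam * t y ≤ 2 * lam * (2 * (κ * ρ)) := by gcongr
    nlinarith
  obtain ⟨u, huS, huc, hcov, hsum⟩ := h.exists_transition_cover (Ω := Ω) (U := ball z (2 * ρ)) (S := S)
    hE (t := t) (T := 2 * (κ * ρ)) (Q := 2 * D) (le_mul_of_one_le_right' hD1)
    (ENNReal.mul_ne_top (by norm_num) hDt)
    (fun y hy => (ht y hy).1) (fun y hy => (ht y hy).2.1.le)
    (fun y hy => hsub y hy.1 _ (by have := htl y hy; have := (ht y hy).1; nlinarith))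
    (fun y hy => (closedBall_subset_ball' (ε₂ := 4 * ρ)
      (by linarith [htl y hy, mem_ball.1 hy.1])).trans hΩ)
    (fun y hy => (ht y hy).2.2) hn
  have hm0 : μ (E ∩ ball z ρ) ≠ 0 := by
    intro h0
    rw [h0, mul_zero, nonpos_iff_eq_zero, mul_eq_zero] at h1
    exact h1.elim hθ0 (h.measure_ball_pos z hρ).ne'
  have hmt : μ (E ∩ ball z ρ) ≠ ⊤ :=
    ((measure_mono inter_subset_right).trans_lt (h.measure_ball_lt_top z ρ)).ne
  have hlt : μ (E ∩ ball z ρ) / 2 < ∑' y : u, μ (ball (y : X) (5 * lam * t y)) := by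
    refine (ENNReal.half_lt_self hm0 hmt).trans_le (hae.trans ((measure_mono hcov).trans ?_))
    exact measure_biUnion_le μ huc _
  obtain ⟨F, hF, hFlt⟩ := exists_finset_lt_sum (f := fun y => μ (ball y (5 * lam * t y))) hlt
  filter_upwards [hsum M v g hv F hF] with i hi
  set G := ∫⁻ y in ball z (2 * ρ), g i y ∂μ
  have hm : μ (E ∩ ball z ρ) / 2 ≤ ENNReal.ofReal (2 * (κ * ρ)) *
      (2 * (2 * D) * D ^ n * ENNReal.ofReal CP * G) := by
    calc μ (E ∩ ball z ρ) / 2 ≤ ∑ y ∈ F, μ (ball y (5 * lam * t y)) := hFlt.le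
      _ ≤ ∑ y ∈ F, ENNReal.ofReal (2 * (κ * ρ)) *
            (μ (ball y (5 * lam * t y)) / ENNReal.ofReal (t y)) := by
          refine Finset.sum_le_sum fun y hy => ?_
          have hy' := ht y (huS (hF hy))
          calc μ (ball y (5 * lam * t y)) = ENNReal.ofReal (t y) *
                (μ (ball y (5 * lam * t y)) / ENNReal.ofReal (t y)) :=
                (ENNReal.mul_div_cancel (ENNReal.ofReal_pos.2 hy'.1).ne'
                  ENNReal.ofReal_ne_top).symm
            _ ≤ _ := by gcongr; exact hy'.2.1.le
      _ = ENNReal.ofReal (2 * (κ * ρ)) *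
            ∑ y ∈ F, μ (ball y (5 * lam * t y)) / ENNReal.ofReal (t y) := by rw [Finset.mul_sum]
      _ ≤ _ := by gcongr
  have hm' : μ (E ∩ ball z ρ) ≤ 2 * (ENNReal.ofReal (2 * (κ * ρ)) *
      (2 * (2 * D) * D ^ n * ENNReal.ofReal CP * G)) := by
    calc μ (E ∩ ball z ρ) = 2 * (μ (E ∩ ball z ρ) / 2) :=
          (ENNReal.mul_div_cancel (by norm_num) (by norm_num)).symm
      _ ≤ _ := by gcongr
  have hconst : 128 * ENNReal.ofReal κ * (D ^ (n + 3) * ENNReal.ofReal CP) ≤ 1 := by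
    rw [hD, ← ENNReal.ofReal_pow (by linarith [h.hCd]), ← ENNReal.ofReal_mul (by have := h.hCd; positivity),
      show (128 : ℝ≥0∞) = ENNReal.ofReal 128 by norm_num, ← ENNReal.ofReal_mul (by norm_num),
      ← ENNReal.ofReal_mul (by positivity)]
    exact ENNReal.ofReal_le_one.2 hκC
  calc 2 * μ E' ≤ 2 * (2 * θ * μ (ball z (4 * ρ))) := by gcongr
    _ ≤ 2 * (2 * θ * (D ^ 2 * μ (ball z ρ))) := by
        gcongr
        exact h.measure_ball_le hρ 2 (by rw [dist_self]; linarith)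
    _ = 4 * D ^ 2 * (θ * μ (ball z ρ)) := by ring
    _ ≤ 4 * D ^ 2 * (2 * (2 * (ENNReal.ofReal (2 * (κ * ρ)) *
      (2 * (2 * D) * D ^ n * ENNReal.ofReal CP * G)))) := by
        exact mul_le_mul_right (h1.trans (by gcongr)) _
    _ = (128 * ENNReal.ofReal κ * (D ^ (n + 3) * ENNReal.ofReal CP)) * (ENNReal.ofReal ρ * G) := by
        rw [ENNReal.ofReal_mul (by norm_num), ENNReal.ofReal_mul hκ0.le, ENNReal.ofReal_ofNat]
        ring
    _ ≤ 1 * (ENNReal.ofReal ρ * G) := by gcongr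
    _ = _ := one_mul _

end Covering

/-! ### Truncation near a finite family of balls -/

section Truncation

/-- The ramp function `s ↦ max (min s 1) 0`. -/
def ramp (s : ℝ) : ℝ := max (min s 1) 0

theorem ramp_nonneg (s : ℝ) : 0 ≤ ramp s := le_max_right _ _

theorem ramp_le_one (s : ℝ) : ramp s ≤ 1 := max_le (min_le_right _ _) zero_le_one

theorem ramp_of_le_zero {s : ℝ} (hs : s ≤ 0) : ramp s = 0 :=
  max_eq_right ((min_le_left _ _).trans hs)

theorem ramp_of_one_le {s : ℝ} (hs : 1 ≤ s) : ramp s = 1 := by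
  rw [ramp, min_eq_right hs, max_eq_left zero_le_one]

theorem pos_of_ramp_pos {s : ℝ} (hs : 0 < ramp s) : 0 < s := by
  by_contra h
  exact hs.ne' (ramp_of_le_zero (not_lt.1 h))

theorem abs_ramp_sub_le (s t : ℝ) : |ramp s - ramp t| ≤ |s - t| := by
  refine (abs_max_sub_max_le_abs _ _ _).trans ((abs_min_sub_min_le_max _ _ _ _).trans ?_)
  simp

omit [MeasurableSpace X] in
theorem LocLipschitzOn.continuousOn_curve {w : X → ℝ} {Ω : Set X} (hw : LocLipschitzOn w Ω)
    {γ : Curve X} (hγ : γ.In Ω) : ContinuousOn (fun t => w (γ.toFun t)) (Icc 0 1) := by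
  obtain ⟨L, hL⟩ := hw (γ.toFun '' Icc 0 1) (isCompact_Icc.image_of_continuousOn γ.continuousOn)
    (image_subset_iff.2 hγ)
  exact hL.continuousOn.comp γ.continuousOn (mapsTo_image _ _)

omit [MeasurableSpace X] in
theorem LocLipschitzOn.continuousOn [ProperSpace X] {w : X → ℝ} {Ω : Set X}
    (hw : LocLipschitzOn w Ω) (hΩ : IsOpen Ω) : ContinuousOn w Ω := by
  intro y hy
  obtain ⟨ε, hε, hsub⟩ := Metric.isOpen_iff.1 hΩ y hy
  have hsub' : closedBall y (ε / 2) ⊆ Ω := (closedBall_subset_ball (by linarith)).trans hsub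
  obtain ⟨L, hL⟩ := hw _ (isCompact_closedBall y (ε / 2)) hsub'
  exact (hL.continuousOn.continuousAt (closedBall_mem_nhds y (by positivity))).continuousWithinAt

omit [MeasurableSpace X] in
theorem LocLipschitzOn.inf {w φ : X → ℝ} {Ω : Set X} (hw : LocLipschitzOn w Ω)
    (hφ : LocLipschitzOn φ Ω) : LocLipschitzOn (fun y => min (w y) (φ y)) Ω := by
  intro K hK hKΩ
  obtain ⟨L, hL⟩ := hw K hK hKΩ
  obtain ⟨L', hL'⟩ := hφ K hK hKΩ
  refine ⟨max L L', LipschitzOnWith.of_dist_le_mul fun a ha b hb => ?_⟩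
  rw [Real.dist_eq]
  refine (abs_min_sub_min_le_max _ _ _ _).trans (max_le ?_ ?_)
  · refine (hL.dist_le_mul a ha b hb).trans ?_
    gcongr
    exact le_max_left _ _
  · refine (hL'.dist_le_mul a ha b hb).trans ?_
    gcongr
    exact le_max_right _ _

omit [MeasurableSpace X] in
theorem curveIntegral_const_mul {c : ℝ≥0∞} (hc : c ≠ ⊤) (g : X → ℝ≥0∞) (γ : Curve X) :
    curveIntegral (fun y => c * g y) γ = c * curveIntegral g γ := by
  unfold curveIntegral
  rw [← lintegral_const_mul' _ _ hc]
  simp only [mul_assoc]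

omit [MeasurableSpace X] in
theorem curveIntegral_sub_le_of_Ioo {f g : X → ℝ≥0∞} {γ : Curve X} {a b : ℝ} (ha : 0 ≤ a)
    (hab : a < b) (hb : b ≤ 1) (hfg : ∀ t ∈ Ioo a b, f (γ.toFun t) ≤ g (γ.toFun t)) :
    curveIntegral f (γ.sub ha hab hb) ≤ curveIntegral g γ := by
  rw [curveIntegral_sub, ← setLIntegral_congr Ioo_ae_eq_Icc]
  refine (setLIntegral_mono' measurableSet_Ioo fun t ht => mul_le_mul_left (hfg t ht) _).trans ?_
  exact lintegral_mono_set (Ioo_subset_Icc_self.trans (Icc_subset_Icc ha hb))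

omit [MeasurableSpace X] in
theorem IsUpperGradientOn.inf {g : X → ℝ≥0∞} {w φ : X → ℝ} {Ω A Z W : Set X} {L : ℝ}
    (hg : IsUpperGradientOn g w Ω) (hw : LocLipschitzOn w Ω) (hw0 : ∀ y, 0 ≤ w y)
    (hWw : ∀ y ∈ Ω, 0 < w y → y ∈ W) (hL : 0 ≤ L) (hφ : ∀ y z, |φ y - φ z| ≤ L * dist y z)
    (hA : ∀ x ∉ A, (∀ y, φ x ≤ φ y) ∨ ∀ y, φ y ≤ φ x) (hφ0 : ∀ y, 0 ≤ φ y)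
    (hZ : ∀ y ∈ Z, φ y = 0) :
    IsUpperGradientOn
      (fun y => Zᶜ.indicator g y + (A ∩ W).indicator (fun _ => ENNReal.ofReal L) y)
      (fun y => min (w y) (φ y)) Ω := by
  intro γ hγ
  set g' : X → ℝ≥0∞ :=
    fun y => Zᶜ.indicator g y + (A ∩ W).indicator (fun _ => ENNReal.ofReal L) y with hg'
  set f : ℝ → ℝ := fun t => min (w (γ.toFun t)) (φ (γ.toFun t)) with hf
  have hφl : LocLipschitzOn φ Ω := fun K _ _ => ⟨L.toNNReal, LipschitzOnWith.of_dist_le_mul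
    fun y _ z _ => by rw [Real.dist_eq, Real.coe_toNNReal _ hL]; exact hφ y z⟩
  have hfc : ContinuousOn f (Icc 0 1) := (hw.inf hφl).continuousOn_curve hγ
  have hf0 : ∀ t, 0 ≤ f t := fun t => le_min (hw0 _) (hφ0 _)
  have key : ∀ a b, 0 ≤ a → a < b → b ≤ 1 → (∀ t ∈ Ioo a b, 0 < f t) →
      ENNReal.ofReal |f b - f a| ≤ curveIntegral g' γ := by
    intro a b ha hab hb hpos
    have hin : (γ.sub ha hab hb).In Ω :=
      Curve.sub_in fun t ht => hγ t ⟨ha.trans ht.1, ht.2.trans hb⟩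
    have h1 := hg _ hin
    have h2 := lipschitz_le_curveIntegral hL hφ hA (γ.sub ha hab hb)
    simp only [Curve.sub, mul_one, mul_zero, add_zero, add_sub_cancel] at h1 h2
    refine (ENNReal.ofReal_le_ofReal (abs_min_sub_min_le_max _ _ _ _)).trans ?_
    rw [ENNReal.ofReal_max]
    refine max_le (h1.trans ?_) (h2.trans ?_)
    · refine curveIntegral_sub_le_of_Ioo ha hab hb fun t ht => ?_
      have : γ.toFun t ∈ Zᶜ := fun hz =>
        ((hpos t ht).trans_le (min_le_right _ _)).ne' (hZ _ hz)
      simp only [hg', indicator_of_mem this]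
      exact le_self_add
    · refine curveIntegral_sub_le_of_Ioo ha hab hb fun t ht => ?_
      have : γ.toFun t ∈ W := hWw _ (hγ t ⟨ha.trans ht.1.le, ht.2.le.trans hb⟩)
        ((hpos t ht).trans_le (min_le_left _ _))
      by_cases hAt : γ.toFun t ∈ A
      · simp only [hg', indicator_of_mem hAt, indicator_of_mem (mem_inter hAt this)]
        exact le_add_self
      · simp [hAt]
  by_cases hz : ∃ t ∈ Icc (0 : ℝ) 1, f t = 0
  · obtain ⟨t, ht, htz⟩ := hz
    have hcl : IsCompact (Icc (0 : ℝ) 1 ∩ f ⁻¹' {0}) :=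
      isCompact_Icc.of_isClosed_subset
        (hfc.preimage_isClosed_of_isClosed isClosed_Icc isClosed_singleton) inter_subset_left
    have hne : (Icc (0 : ℝ) 1 ∩ f ⁻¹' {0}).Nonempty := ⟨t, ht, htz⟩
    obtain ⟨p, hp⟩ := hcl.exists_isLeast hne
    obtain ⟨q, hq⟩ := hcl.exists_isGreatest hne
    have hpz : f p = 0 := hp.1.2
    have hqz : f q = 0 := hq.1.2
    have h0 : ENNReal.ofReal (f 0) ≤ curveIntegral g' γ := by
      rcases hp.1.1.1.eq_or_lt with h | h
      · rw [h, hpz, ENNReal.ofReal_zero]; exact zero_le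
      · have := key 0 p le_rfl h hp.1.1.2 fun s hs => (hf0 s).lt_of_ne fun h0 =>
          not_le.2 hs.2 (hp.2 ⟨⟨hs.1.le, hs.2.le.trans hp.1.1.2⟩, h0.symm⟩)
        rwa [hpz, zero_sub, abs_neg, abs_of_nonneg (hf0 _)] at this
    have h1 : ENNReal.ofReal (f 1) ≤ curveIntegral g' γ := by
      rcases hq.1.1.2.eq_or_lt with h | h
      · rw [← h, hqz, ENNReal.ofReal_zero]; exact zero_le
      · have := key q 1 hq.1.1.1 h le_rfl fun s hs => (hf0 s).lt_of_ne fun h0 =>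
          not_le.2 hs.1 (hq.2 ⟨⟨hq.1.1.1.trans hs.1.le, hs.2.le⟩, h0.symm⟩)
        rwa [hqz, sub_zero, abs_of_nonneg (hf0 _)] at this
    refine (ENNReal.ofReal_le_ofReal (?_ : _ ≤ max (f 1) (f 0))).trans ?_
    · have a0 := hf0 0
      have a1 := hf0 1
      change |f 1 - f 0| ≤ _
      rw [abs_le]
      constructor
      · linarith [le_max_right (f 1) (f 0)]
      · linarith [le_max_left (f 1) (f 0)]
    · rw [ENNReal.ofReal_max]
      exact max_le h1 h0
  · push Not at hz
    exact key 0 1 le_rfl one_pos le_rfl fun t ht =>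
      (hf0 t).lt_of_ne (hz t (Ioo_subset_Icc_self ht)).symm

theorem exists_truncation [BorelSpace X] {v : X → ℝ} {g : X → ℝ≥0∞} {Ω W : Set X}
    (hv : LocLipschitzOn v Ω) (hgm : Measurable g) (hg : IsUpperGradientOn g v Ω) {τ : ℝ}
    (hτ : 0 < τ) (hW : MeasurableSet W) (hWv : ∀ y ∈ Ω, 0 < ramp ((1 + τ) * v y - τ) → y ∈ W)
    (F : Finset X) (ρ : X → ℝ) (hρ : ∀ z ∈ F, 0 < ρ z) :
    ∃ (w : X → ℝ) (g' : X → ℝ≥0∞), LocLipschitzOn w Ω ∧ Measurable g' ∧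
      IsUpperGradientOn g' w Ω ∧ (∀ y, 0 ≤ w y ∧ w y ≤ ramp ((1 + τ) * v y - τ)) ∧
      (∀ y, (∀ z ∈ F, y ∉ ball z (4 * ρ z)) → w y = ramp ((1 + τ) * v y - τ)) ∧
      ∀ y, g' y ≤ (⋃ z ∈ F, ball z (2 * ρ z))ᶜ.indicator (fun y => ENNReal.ofReal (1 + τ) * g y) y +
        ∑ z ∈ F, (ball z (4 * ρ z) ∩ W).indicator (fun _ => ENNReal.ofReal (2 * ρ z)⁻¹) y := by
  classical
  induction F using Finset.induction_on with
  | empty =>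
    have hT : ∀ s t : ℝ, |ramp ((1 + τ) * s - τ) - ramp ((1 + τ) * t - τ)| ≤ (1 + τ) * |s - t| := by
      intro s t
      refine (abs_ramp_sub_le _ _).trans (le_of_eq ?_)
      rw [← abs_of_pos (show 0 < 1 + τ by linarith), ← abs_mul, abs_of_pos (show 0 < 1 + τ by linarith)]
      ring_nf
    refine ⟨fun y => ramp ((1 + τ) * v y - τ), fun y => ENNReal.ofReal (1 + τ) * g y, ?_,
      hgm.const_mul _, ?_, fun y => ⟨ramp_nonneg _, le_rfl⟩, fun y _ => rfl, fun y => by simp⟩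
    · intro K hK hKΩ
      obtain ⟨L, hL⟩ := hv K hK hKΩ
      refine ⟨(1 + τ).toNNReal * L, LipschitzOnWith.of_dist_le_mul fun a ha b hb => ?_⟩
      rw [Real.dist_eq, NNReal.coe_mul, Real.coe_toNNReal _ (by linarith), mul_assoc]
      exact (hT _ _).trans (by gcongr; exact hL.dist_le_mul a ha b hb)
    · intro γ hγ
      rw [curveIntegral_const_mul ENNReal.ofReal_ne_top]
      refine (ENNReal.ofReal_le_ofReal (hT _ _)).trans ?_
      rw [ENNReal.ofReal_mul (by linarith)]
      gcongr
      exact hg γ hγ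
  | insert z F hz ih =>
    obtain ⟨w, g', hw, hg'm, hg', hw0, hwF, hg'F⟩ := ih fun a ha => hρ a (Finset.mem_insert_of_mem ha)
    have hρz : 0 < ρ z := hρ z (Finset.mem_insert_self _ _)
    set φ : X → ℝ := fun y => ramp ((dist y z - 2 * ρ z) * (2 * ρ z)⁻¹) with hφ
    have hinv : 0 < (2 * ρ z)⁻¹ := by positivity
    have hφL : ∀ y y', |φ y - φ y'| ≤ (2 * ρ z)⁻¹ * dist y y' := by
      intro y y'
      refine (abs_ramp_sub_le _ _).trans ?_
      rw [← sub_mul, abs_mul, abs_of_pos hinv, mul_comm, sub_sub_sub_cancel_right]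
      gcongr
      exact abs_dist_sub_le _ _ _
    have hφ1 : ∀ y ∉ ball z (4 * ρ z), φ y = 1 := by
      intro y hy
      refine ramp_of_one_le ?_
      rw [← div_eq_mul_inv, le_div_iff₀ (by positivity)]
      rw [mem_ball, not_lt] at hy
      linarith
    refine ⟨fun y => min (w y) (φ y), _, hw.inf fun K _ _ => ⟨(2 * ρ z)⁻¹.toNNReal,
      LipschitzOnWith.of_dist_le_mul fun y _ y' _ => by
        rw [Real.dist_eq, Real.coe_toNNReal _ hinv.le]; exact hφL y y'⟩, ?_,
      hg'.inf (A := ball z (4 * ρ z)) (Z := ball z (2 * ρ z)) (W := W) hw (fun y => (hw0 y).1)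
        (fun y hy hpos => hWv y hy (hpos.trans_le (hw0 y).2)) hinv.le hφL
        (fun y hy => Or.inr fun y' => by rw [hφ1 y hy]; exact ramp_le_one _)
        (fun y => ramp_nonneg _) (fun y hy => ?_), fun y => ⟨le_min (hw0 y).1 (ramp_nonneg _),
        (min_le_left _ _).trans (hw0 y).2⟩, fun y hy => ?_, fun y => ?_⟩
    · exact (hg'm.indicator measurableSet_ball.compl).add
        (measurable_const.indicator (measurableSet_ball.inter hW))
    · refine ramp_of_le_zero (mul_nonpos_of_nonpos_of_nonneg ?_ hinv.le)
      linarith [mem_ball.1 hy]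
    · beta_reduce
      rw [hφ1 y (hy z (Finset.mem_insert_self _ _)), hwF y fun a ha =>
        hy a (Finset.mem_insert_of_mem ha), min_eq_left (ramp_le_one _)]
    · rw [Finset.sum_insert hz, add_comm ((ball z (4 * ρ z) ∩ W).indicator _ y), ← add_assoc]
      gcongr
      by_cases hyz : y ∈ ball z (2 * ρ z)
      · rw [indicator_of_notMem (by simpa using hyz)]
        exact zero_le
      · rw [indicator_of_mem (by simpa using hyz)]
        refine (hg'F y).trans ?_
        gcongr ?_ + _
        by_cases hyF : y ∈ ⋃ z ∈ F, ball z (2 * ρ z)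
        · rw [indicator_of_notMem (by simpa using hyF)]
          exact zero_le
        · rw [indicator_of_mem (by simpa using hyF), indicator_of_mem]
          rw [mem_compl_iff, Finset.set_biUnion_insert, mem_union, not_or]
          exact ⟨hyz, hyF⟩

end Truncation

/-! ### Points of small density -/

section SmallDensity

variable {μ : Measure X} {Cd CP lam : ℝ}

/-- `A` is covered by countably many balls centred in `ball x r`, of radius at most `T`, whose
codimension one content is at most `M`. -/
def HasCover (μ : Measure X) (x : X) (r T : ℝ) (A : Set X) (M : ℝ≥0∞) : Prop :=
  ∃ D : Set (X × ℝ), D.Countable ∧ (∀ p ∈ D, 0 < p.2 ∧ p.2 ≤ T ∧ p.1 ∈ ball x r) ∧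
    A ⊆ ⋃ p ∈ D, ball p.1 p.2 ∧ ∑' p : D, μ (ball p.1.1 p.1.2) / ENNReal.ofReal p.1.2 ≤ M

theorem HasCover.mono {x : X} {r T : ℝ} {A B : Set X} {M M' : ℝ≥0∞} (h : HasCover μ x r T B M)
    (hAB : A ⊆ B) (hM : M ≤ M') : HasCover μ x r T A M' := by
  obtain ⟨D, hD, hp, hB, hs⟩ := h
  exact ⟨D, hD, hp, hAB.trans hB, hs.trans hM⟩

theorem HasCover.iUnion {x : X} {r T : ℝ} {A : ℕ → Set X} {M : ℕ → ℝ≥0∞}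
    (h : ∀ n, HasCover μ x r T (A n) (M n)) : HasCover μ x r T (⋃ n, A n) (∑' n, M n) := by
  choose D hD hp hA hs using h
  refine ⟨⋃ n, D n, countable_iUnion hD, fun p hpD => ?_, iUnion_subset fun n => ?_, ?_⟩
  · obtain ⟨n, hn⟩ := mem_iUnion.1 hpD
    exact hp n p hn
  · exact (hA n).trans (biUnion_subset_biUnion_left (subset_iUnion D n))
  · exact (ENNReal.tsum_iUnion_le_tsum
      (fun p : X × ℝ => μ (ball p.1 p.2) / ENNReal.ofReal p.2) D).trans (ENNReal.tsum_le_tsum hs)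

theorem HasCover.union {x : X} {r T : ℝ} {A B : Set X} {M M' : ℝ≥0∞}
    (hA : HasCover μ x r T A M) (hB : HasCover μ x r T B M') :
    HasCover μ x r T (A ∪ B) (M + M') := by
  obtain ⟨D, hD, hp, hA, hs⟩ := hA
  obtain ⟨D', hD', hp', hB, hs'⟩ := hB
  refine ⟨D ∪ D', hD.union hD', fun p h => h.elim (hp p) (hp' p), ?_, ?_⟩
  · rw [biUnion_union]
    exact union_subset_union hA hB
  · exact (ENNReal.tsum_union_le
      (fun p : X × ℝ => μ (ball p.1 p.2) / ENNReal.ofReal p.2) D D').trans (add_le_add hs hs')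

theorem tsum_le_of_forall_finset {ι : Type*} {f : ι → ℝ≥0∞} {u : Set ι} {a : ℝ≥0∞}
    (h : ∀ F : Finset ι, ↑F ⊆ u → ∑ i ∈ F, f i ≤ a) : ∑' i : u, f i ≤ a := by
  by_contra hcon
  obtain ⟨F, hF, hlt⟩ := exists_finset_lt_sum (not_le.1 hcon)
  exact absurd (h F hF) (not_le.2 hlt)

theorem hasCover_of_finset {x : X} {r T : ℝ} {A u : Set X} {M : ℝ≥0∞} {ρ : X → ℝ}
    (hu : u.Countable) (hρ : ∀ z ∈ u, 0 < ρ z ∧ ρ z ≤ T ∧ z ∈ ball x r)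
    (hA : A ⊆ ⋃ z ∈ u, ball z (ρ z))
    (h : ∀ F : Finset X, ↑F ⊆ u → ∑ z ∈ F, μ (ball z (ρ z)) / ENNReal.ofReal (ρ z) ≤ M) :
    HasCover μ x r T A M := by
  refine ⟨(fun z => (z, ρ z)) '' u, hu.image _, ?_, ?_, ?_⟩
  · rintro _ ⟨z, hz, rfl⟩
    exact hρ z hz
  · rwa [biUnion_image]
  · rw [tsum_image (fun p : X × ℝ => μ (ball p.1 p.2) / ENNReal.ofReal p.2)
      (fun a _ b _ hab => (Prod.ext_iff.1 hab).1)]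
    exact tsum_le_of_forall_finset (f := fun z => μ (ball z (ρ z)) / ENNReal.ofReal (ρ z)) h

omit [MetricSpace X] [MeasurableSpace X] in
theorem abs_ramp_sub_chi_le {E : Set X} {τ : ℝ} (hτ : 0 < τ) (s : ℝ) (y : X) :
    |ramp ((1 + τ) * s - τ) - chi E y| ≤ (1 + τ) * |s - chi E y| := by
  have h : ∀ c : ℝ, ramp ((1 + τ) * c - τ) = c →
      |ramp ((1 + τ) * s - τ) - c| ≤ (1 + τ) * |s - c| := by
    intro c hc
    nth_rewrite 1 [← hc]
    refine (abs_ramp_sub_le _ _).trans (le_of_eq ?_)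
    rw [sub_sub_sub_cancel_right, ← mul_sub, abs_mul, abs_of_pos (by linarith)]
  refine h _ ?_
  by_cases hy : y ∈ E
  · rw [chi, indicator_of_mem hy]
    exact ramp_of_one_le (by linarith)
  · rw [chi, indicator_of_notMem hy]
    exact ramp_of_le_zero (by linarith)

omit [MeasurableSpace X] in
theorem isOpen_superlevel [ProperSpace X] {v : X → ℝ} {Ω : Set X} (hv : LocLipschitzOn v Ω)
    (hΩ : IsOpen Ω) (τ : ℝ) : IsOpen {y | y ∈ Ω ∧ 0 < (1 + τ) * v y - τ} := by
  have : ContinuousOn (fun y => (1 + τ) * v y - τ) Ω :=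
    ((hv.continuousOn hΩ).const_smul (1 + τ)).sub continuousOn_const
  exact this.isOpen_inter_preimage hΩ isOpen_Ioi

theorem IsApprox.eventually_measure_superlevel_le [BorelSpace X] [ProperSpace X] {E Ω : Set X}
    (hE : MeasurableSet E) (hΩ : IsOpen Ω) {M : ℝ≥0∞} {v : ℕ → X → ℝ} {g : ℕ → X → ℝ≥0∞}
    (hv : IsApprox μ E Ω M v g) {τ : ℝ} (hτ : 0 < τ) {z : X} {s : ℝ} (hs : closedBall z s ⊆ Ω)
    (hm : μ (E ∩ ball z s) ≠ 0) :
    ∀ᶠ i in atTop, μ (ball z s ∩ {y | y ∈ Ω ∧ 0 < (1 + τ) * v i y - τ}) ≤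
      2 * μ (E ∩ ball z s) := by
  set c : ℝ := τ / (1 + τ) with hc
  have hc0 : 0 < c := by positivity
  have hc' : ENNReal.ofReal c ≠ 0 := (ENNReal.ofReal_pos.2 hc0).ne'
  have hpos : 0 < ENNReal.ofReal c * μ (E ∩ ball z s) :=
    ENNReal.mul_pos hc' hm
  filter_upwards [(hv.tendsto _ (isCompact_closedBall z s) hs).eventually_lt_const hpos] with i hi
  set W : Set X := {y | y ∈ Ω ∧ 0 < (1 + τ) * v i y - τ} with hW
  have hWm : MeasurableSet W := (isOpen_superlevel (hv.lip i) hΩ τ).measurableSet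
  set A := (ball z s ∩ W) \ E with hA
  have hAm : MeasurableSet A := (measurableSet_ball.inter hWm).diff hE
  have h1 : ENNReal.ofReal c * μ A ≤ ENNReal.ofReal c * μ (E ∩ ball z s) := by
    calc ENNReal.ofReal c * μ A = ∫⁻ _ in A, ENNReal.ofReal c ∂μ := (setLIntegral_const _ _).symm
      _ ≤ ∫⁻ y in A, ENNReal.ofReal |v i y - chi E y| ∂μ := by
          refine setLIntegral_mono' hAm fun y hy => ENNReal.ofReal_le_ofReal ?_
          rw [chi, indicator_of_notMem hy.2, sub_zero]
          refine le_trans ?_ (le_abs_self _)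
          rw [hc, div_le_iff₀ (by linarith)]
          linarith [hy.1.2.2]
      _ ≤ ∫⁻ y in closedBall z s, ENNReal.ofReal |v i y - chi E y| ∂μ :=
          lintegral_mono_set fun y hy => ball_subset_closedBall hy.1.1
      _ ≤ _ := hi.le
  have h2 : μ A ≤ μ (E ∩ ball z s) :=
    (ENNReal.mul_le_mul_iff_right hc' ENNReal.ofReal_ne_top).1 h1
  calc μ (ball z s ∩ W) ≤ μ (E ∩ ball z s ∪ A) := by
        refine measure_mono fun y hy => ?_
        by_cases hyE : y ∈ E
        · exact Or.inl ⟨hyE, hy.1⟩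
        · exact Or.inr ⟨hy, hyE⟩
    _ ≤ μ (E ∩ ball z s) + μ A := measure_union_le _ _
    _ ≤ _ := by rw [two_mul]; gcongr

/-- Truncating an almost optimal function near a finite family of balls decreases the energy by
a definite fraction of the energy in these balls; lower semicontinuity bounds this gain. -/
theorem add_half_sum_le [BorelSpace X] [ProperSpace X] {E Ω K : Set X}
    (hΩ : IsOpen Ω) {P η δ : ℝ≥0∞}
    (hlsc : ∀ (w : X → ℝ) (g : X → ℝ≥0∞), LocLipschitzOn w Ω → Measurable g →
      IsUpperGradientOn g w Ω → ∫⁻ z in K, ENNReal.ofReal |w z - chi E z| ∂μ < δ →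
      P ≤ ∫⁻ z in Ω, g z ∂μ + η)
    {v : X → ℝ} {g : X → ℝ≥0∞} (hv : LocLipschitzOn v Ω) (hgm : Measurable g)
    (hg : IsUpperGradientOn g v Ω) {τ : ℝ} (hτ : 0 < τ) (F : Finset X) {ρ : X → ℝ}
    (hρ : ∀ z ∈ F, 0 < ρ z) (hsub : ∀ z ∈ F, ball z (4 * ρ z) ⊆ Ω)
    (hdisj : (F : Set X).PairwiseDisjoint fun z => ball z (4 * ρ z))
    (hcost : ∀ z ∈ F, ENNReal.ofReal (2 * ρ z)⁻¹ *
      μ (ball z (4 * ρ z) ∩ {y | y ∈ Ω ∧ 0 < (1 + τ) * v y - τ}) ≤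
        (∫⁻ y in ball z (2 * ρ z), g y ∂μ) / 2)
    (hclose : ENNReal.ofReal (1 + τ) * ∫⁻ y in K, ENNReal.ofReal |v y - chi E y| ∂μ +
      ∑ z ∈ F, μ (ball z (4 * ρ z)) < δ) :
    P + (∑ z ∈ F, ∫⁻ y in ball z (2 * ρ z), g y ∂μ) / 2 ≤
      ENNReal.ofReal (1 + τ) * ∫⁻ y in Ω, g y ∂μ + η := by
  set W : Set X := {y | y ∈ Ω ∧ 0 < (1 + τ) * v y - τ} with hW
  have hWm : MeasurableSet W := (isOpen_superlevel hv hΩ τ).measurableSet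
  have hτ1 : 1 ≤ ENNReal.ofReal (1 + τ) := ENNReal.one_le_ofReal.2 (by linarith)
  obtain ⟨w, g', hw, hg'm, hg', hw01, hwv, hg'le⟩ := exists_truncation hv hgm hg hτ hWm
    (fun y hy hpos => ⟨hy, pos_of_ramp_pos hpos⟩) F ρ hρ
  have hwclose : ∫⁻ z in K, ENNReal.ofReal |w z - chi E z| ∂μ < δ := by
    refine lt_of_le_of_lt ?_ hclose
    set B : Set X := ⋃ z ∈ F, ball z (4 * ρ z) with hB
    have hBm : MeasurableSet B := Finset.measurableSet_biUnion F fun _ _ => measurableSet_ball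
    calc ∫⁻ z in K, ENNReal.ofReal |w z - chi E z| ∂μ
        ≤ ∫⁻ z in K, (ENNReal.ofReal (1 + τ) * ENNReal.ofReal |v z - chi E z| +
            B.indicator (fun _ => 1) z) ∂μ := by
          refine lintegral_mono fun y => ?_
          by_cases hy : y ∈ B
          · rw [indicator_of_mem hy]
            refine le_trans ?_ le_add_self
            refine ENNReal.ofReal_le_one.2 ?_
            have h1 := hw01 y
            have h2 := ramp_le_one ((1 + τ) * v y - τ)
            by_cases hyE : y ∈ E
            · rw [chi, indicator_of_mem hyE, abs_le]
              constructor <;> linarith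
            · rw [chi, indicator_of_notMem hyE, abs_le]
              constructor <;> linarith
          · rw [indicator_of_notMem hy, add_zero, ← ENNReal.ofReal_mul (by linarith)]
            refine ENNReal.ofReal_le_ofReal ?_
            rw [hwv y fun z hz hyz => hy (mem_iUnion₂.2 ⟨z, hz, hyz⟩)]
            exact abs_ramp_sub_chi_le hτ _ _
      _ = ENNReal.ofReal (1 + τ) * ∫⁻ y in K, ENNReal.ofReal |v y - chi E y| ∂μ +
            ∫⁻ y in K, B.indicator (fun _ => 1) y ∂μ := by
          rw [lintegral_add_right _ (measurable_const.indicator hBm),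
            lintegral_const_mul' _ _ ENNReal.ofReal_ne_top]
      _ ≤ _ := by
          gcongr
          calc ∫⁻ y in K, B.indicator (fun _ => 1) y ∂μ ≤ ∫⁻ y, B.indicator (fun _ => 1) y ∂μ :=
                setLIntegral_le_lintegral _ _
            _ = μ B := by rw [lintegral_indicator hBm, setLIntegral_one]
            _ ≤ _ := measure_biUnion_finset_le _ _
  have hP := hlsc w g' hw hg'm hg' hwclose
  set G := ∑ z ∈ F, ∫⁻ y in ball z (2 * ρ z), g y ∂μ with hG
  set U : Set X := ⋃ z ∈ F, ball z (2 * ρ z) with hU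
  have hUm : MeasurableSet U := Finset.measurableSet_biUnion F fun _ _ => measurableSet_ball
  have h24 : ∀ z ∈ F, ball z (2 * ρ z) ⊆ ball z (4 * ρ z) := fun z hz =>
    ball_subset_ball (by linarith [hρ z hz])
  have hUΩ : U ⊆ Ω := iUnion₂_subset fun z hz => (h24 z hz).trans (hsub z hz)
  have hGU : G = ∫⁻ y in U, g y ∂μ := by
    rw [hG, hU, lintegral_biUnion_finset (t := fun z => ball z (2 * ρ z)) _
      fun _ _ => measurableSet_ball]
    exact hdisj.mono_on h24
  have hsplit : ∫⁻ y in Ω \ U, g y ∂μ + G = ∫⁻ y in Ω, g y ∂μ := by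
    rw [hGU, add_comm, ← lintegral_inter_add_sdiff g Ω hUm, inter_eq_right.2 hUΩ]
  rcases eq_or_ne (∫⁻ y in Ω, g y ∂μ) ⊤ with htop | htop
  · rw [htop, ENNReal.mul_top (by positivity), top_add]
    exact le_top
  have hGt : G ≠ ⊤ := ne_top_of_le_ne_top htop (hsplit ▸ le_add_self)
  have hg'int : ∫⁻ y in Ω, g' y ∂μ ≤ ENNReal.ofReal (1 + τ) * ∫⁻ y in Ω \ U, g y ∂μ + G / 2 := by
    calc ∫⁻ y in Ω, g' y ∂μ ≤ ∫⁻ y in Ω, (Uᶜ.indicator (fun y => ENNReal.ofReal (1 + τ) * g y) y +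
          ∑ z ∈ F, (ball z (4 * ρ z) ∩ W).indicator (fun _ => ENNReal.ofReal (2 * ρ z)⁻¹) y) ∂μ :=
          lintegral_mono hg'le
      _ = ENNReal.ofReal (1 + τ) * ∫⁻ y in Ω \ U, g y ∂μ +
            ∑ z ∈ F, ∫⁻ y in Ω, (ball z (4 * ρ z) ∩ W).indicator
              (fun _ => ENNReal.ofReal (2 * ρ z)⁻¹) y ∂μ := by
          rw [lintegral_add_left ((hgm.const_mul _).indicator hUm.compl),
            lintegral_indicator hUm.compl, Measure.restrict_restrict hUm.compl,
            lintegral_const_mul' _ _ ENNReal.ofReal_ne_top, inter_comm, ← sdiff_eq,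
            lintegral_finsetSum _ fun z _ => measurable_const.indicator
              (measurableSet_ball.inter hWm)]
      _ ≤ _ := by
          gcongr
          rw [hG, ENNReal.div_eq_inv_mul, Finset.mul_sum]
          refine Finset.sum_le_sum fun z hz => ?_
          rw [← ENNReal.div_eq_inv_mul]
          refine le_trans ?_ (hcost z hz)
          refine (setLIntegral_le_lintegral _ _).trans (le_of_eq ?_)
          rw [lintegral_indicator (measurableSet_ball.inter hWm), setLIntegral_const]
  have hfin : P + G / 2 + G / 2 ≤ ENNReal.ofReal (1 + τ) * ∫⁻ y in Ω, g y ∂μ + η + G / 2 := by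
    calc P + G / 2 + G / 2 = P + G := by rw [add_assoc, ENNReal.add_halves]
      _ ≤ ENNReal.ofReal (1 + τ) * ∫⁻ y in Ω \ U, g y ∂μ + G / 2 + η +
            ENNReal.ofReal (1 + τ) * G := by
          gcongr
          · exact hP.trans (by gcongr)
          · exact le_mul_of_one_le_left' hτ1
      _ = _ := by rw [← hsplit, mul_add]; ring
  exact (ENNReal.add_le_add_iff_right (ENNReal.div_ne_top hGt (by norm_num))).1 hfin

end SmallDensity

section SparsePoints

variable {μ : Measure X} {Cd CP lam : ℝ}

/-- The density of `E` in small balls around `z` is at most of order `θ`, and of that order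
in arbitrarily small balls. -/
def IsSparseAt (μ : Measure X) (E : Set X) (θ : ℝ≥0∞) (z : X) : Prop :=
  ∀ s : ℝ, 0 < s → ∃ ρ, 0 < ρ ∧ ρ < s ∧
    μ (E ∩ ball z (4 * ρ)) ≤ 2 * θ * μ (ball z (4 * ρ)) ∧
    θ * μ (ball z ρ) ≤ 2 * μ (E ∩ ball z ρ)

theorem MMS.hasCover_of_isSparseAt [BorelSpace X] (h : MMS μ Cd CP lam) {E : Set X}
    (hE : MeasurableSet E) {x : X} {r T : ℝ} (hr : 0 < r) (hT : 0 < T)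
    (hP : perim μ E (ball x (2 * r)) ≠ ⊤) {n k : ℕ} (hn : 5 * lam ≤ 2 ^ n) (hk : 32 * lam ≤ 2 ^ k)
    (hk' : 1024 * Cd ^ (n + 3) * CP ≤ 2 ^ k) {θ : ℝ≥0∞} (hθ0 : θ ≠ 0) (hθt : θ ≠ ⊤)
    {ε : ℝ≥0∞} (hε : ε ≠ 0) {S : Set X} (hS : S ⊆ ball x r)
    (hsp : ∀ z ∈ S, ∃ θ', θ ≤ θ' ∧ 4 * ENNReal.ofReal Cd ^ k * θ' ≤ 1 ∧ IsSparseAt μ E θ' z) :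
    HasCover μ x r T S ε := by
  have := h.properSpace
  set D := ENNReal.ofReal Cd with hD
  set Ω := ball x (2 * r) with hΩ
  set P := perim μ E Ω with hPdef
  have hD1 : 1 ≤ D := h.one_le_ofReal
  have hD0 : D ≠ 0 := (lt_of_lt_of_le one_pos hD1).ne'
  have hDt : D ≠ ⊤ := ENNReal.ofReal_ne_top
  set c : ℝ≥0∞ := D ^ 5 / θ * 6 with hc
  have hc0 : c ≠ 0 := mul_ne_zero (ENNReal.div_ne_zero.2 ⟨pow_ne_zero _ hD0, hθt⟩) (by norm_num)
  have hct : c ≠ ⊤ :=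
    ENNReal.mul_ne_top (ENNReal.div_ne_top (ENNReal.pow_ne_top hDt) hθ0) (by norm_num)
  set η : ℝ≥0∞ := min (ε / c) 1 with hη
  have hη0 : η ≠ 0 := (lt_min (ENNReal.div_pos hε hct) one_pos).ne'
  have hηt : η ≠ ⊤ := ne_top_of_le_ne_top ENNReal.one_ne_top (min_le_right _ _)
  have hcη : c * η ≤ ε := (mul_le_mul_right (min_le_left _ _) c).trans
    (ENNReal.mul_div_cancel hc0 hct).le
  have hPη : P + η ≠ ⊤ := ENNReal.add_ne_top.2 ⟨hP, hηt⟩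
  obtain ⟨τ, hτ, hτη⟩ := ENNReal.exists_nnreal_pos_mul_lt hPη hη0
  obtain ⟨K, hK, hKc, δ, hδ, hlsc⟩ := exists_compact_perim_le h hP hη0
  have hδ2 : δ / 2 ≠ 0 := (ENNReal.half_pos hδ).ne'
  have hDθ : D ^ 2 / θ ≠ ⊤ := ENNReal.div_ne_top (ENNReal.pow_ne_top hDt) hθ0
  obtain ⟨s, hs, hsδ⟩ := ENNReal.exists_nnreal_pos_mul_lt (ENNReal.mul_ne_top hDθ hPη) hδ2
  obtain ⟨v, g, hv⟩ := exists_isApprox (μ := μ) (E := E) (Ω := Ω) (M := P + η)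
    (ENNReal.lt_add_right hP hη0)
  have hchoice : ∀ z, ∃ ρ : ℝ, z ∈ S → ∃ θ', θ ≤ θ' ∧ 4 * D ^ k * θ' ≤ 1 ∧ 0 < ρ ∧
      ρ < min (s : ℝ) (min (r / 8) (T / 20)) ∧
      μ (E ∩ ball z (4 * ρ)) ≤ 2 * θ' * μ (ball z (4 * ρ)) ∧
      θ' * μ (ball z ρ) ≤ 2 * μ (E ∩ ball z ρ) := by
    intro z
    by_cases hz : z ∈ S
    · obtain ⟨θ', h1, h2, h3⟩ := hsp z hz
      obtain ⟨ρ, hρ⟩ := h3 (min (s : ℝ) (min (r / 8) (T / 20)))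
        (lt_min hs (lt_min (by positivity) (by positivity)))
      exact ⟨ρ, fun _ => ⟨θ', h1, h2, hρ⟩⟩
    · exact ⟨0, fun hz' => absurd hz' hz⟩
  choose ρ hρ using hchoice
  have hρ0 : ∀ z ∈ S, 0 < ρ z := fun z hz => (hρ z hz).choose_spec.2.2.1
  have hρlt : ∀ z ∈ S, ρ z < s ∧ ρ z < r / 8 ∧ ρ z < T / 20 := fun z hz => by
    have := (hρ z hz).choose_spec.2.2.2.1
    rwa [lt_min_iff, lt_min_iff] at this
  have hsub : ∀ z ∈ S, closedBall z (4 * ρ z) ⊆ Ω := fun z hz => by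
    refine closedBall_subset_ball' ?_
    have h1 := hρlt z hz
    have h2 := mem_ball.1 (hS hz)
    linarith
  obtain ⟨u, huS, huc, hdisj, hcov⟩ := h.exists_disjoint_subfamily S id (fun z => 4 * ρ z)
    (R := T) (fun z hz => by linarith [hρ0 z hz]) (fun z hz => by linarith [(hρlt z hz).2.2])
  refine hasCover_of_finset (ρ := fun z => 5 * (4 * ρ z)) huc (fun z hz => ?_) (fun z hz => ?_)
    fun F hF => ?_
  · have h1 := hρlt z (huS hz)
    have h2 := hρ0 z (huS hz)
    exact ⟨by linarith, by linarith, hS (huS hz)⟩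
  · obtain ⟨b, hb, hzb⟩ := hcov z hz
    exact mem_iUnion₂.2 ⟨b, hb, hzb (mem_ball_self (by linarith [hρ0 z hz]))⟩
  have hFS : ∀ z ∈ F, z ∈ S := fun z hz => huS (hF hz)
  have hdens : ∀ z ∈ F, θ * μ (ball z (ρ z)) ≤ 2 * μ (E ∩ ball z (4 * ρ z)) := fun z hz => by
    obtain ⟨θ', h1, -, -, -, -, h5⟩ := hρ z (hFS z hz)
    calc θ * μ (ball z (ρ z)) ≤ θ' * μ (ball z (ρ z)) := by gcongr
      _ ≤ _ := h5
      _ ≤ _ := by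
        gcongr
        linarith [hρ0 z (hFS z hz)]
  have hm0 : ∀ z ∈ F, μ (E ∩ ball z (4 * ρ z)) ≠ 0 := fun z hz h0 => by
    have := hdens z hz
    rw [h0, mul_zero] at this
    exact (mul_ne_zero hθ0 (h.measure_ball_pos z (hρ0 z (hFS z hz))).ne') (le_zero_iff.1 this)
  have hgain : ∀ᶠ i in atTop, ∀ z ∈ F, 2 * μ (E ∩ ball z (4 * ρ z)) ≤
      ENNReal.ofReal (ρ z) * ∫⁻ y in ball z (2 * ρ z), g i y ∂μ := by
    refine (Filter.eventually_all_finset F).2 fun z hz => ?_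
    obtain ⟨θ', h1, h2, h3, -, h4, h5⟩ := hρ z (hFS z hz)
    exact hv.eventually_gain h hE hn hk hk' h3 (ball_subset_closedBall.trans (hsub z (hFS z hz)))
      h2 (lt_of_lt_of_le (pos_iff_ne_zero.2 hθ0) h1).ne' h4 h5
  have hlevel : ∀ᶠ i in atTop, ∀ z ∈ F,
      μ (ball z (4 * ρ z) ∩ {y | y ∈ Ω ∧ 0 < (1 + (τ : ℝ)) * v i y - τ}) ≤
        2 * μ (E ∩ ball z (4 * ρ z)) :=
    (Filter.eventually_all_finset F).2 fun z hz => hv.eventually_measure_superlevel_le hE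
      isOpen_ball hτ (hsub z (hFS z hz)) (hm0 z hz)
  have h1τ : ENNReal.ofReal (1 + (τ : ℝ)) = 1 + τ := by
    rw [ENNReal.ofReal_add zero_le_one τ.coe_nonneg, ENNReal.ofReal_one, ENNReal.ofReal_coe_nnreal]
  have hlim : ∀ᶠ i in atTop, ENNReal.ofReal (1 + (τ : ℝ)) *
      ∫⁻ y in K, ENNReal.ofReal |v i y - chi E y| ∂μ < δ / 2 := by
    have : δ / 2 / ENNReal.ofReal (1 + (τ : ℝ)) ≠ 0 :=
      (ENNReal.div_pos hδ2 ENNReal.ofReal_ne_top).ne'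
    filter_upwards [(hv.tendsto K hKc hK).eventually_lt_const (pos_iff_ne_zero.2 this)] with i hi
    exact ENNReal.mul_lt_of_lt_div' hi
  obtain ⟨i, hg, hl, hi⟩ := (hgain.and (hlevel.and hlim)).exists
  set G : X → ℝ≥0∞ := fun z => ∫⁻ y in ball z (2 * ρ z), g i y ∂μ with hG
  have hFdisj : (F : Set X).PairwiseDisjoint fun z => ball z (4 * ρ z) := hdisj.subset hF
  have hGsum : ∑ z ∈ F, G z ≤ P + η := by
    rw [hG, ← lintegral_biUnion_finset (t := fun z => ball z (2 * ρ z)) (hFdisj.mono_on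
      fun z hz => ball_subset_ball (by linarith [hρ0 z (hFS z hz)])) fun _ _ => measurableSet_ball]
    refine (lintegral_mono_set (iUnion₂_subset fun z hz => ?_)).trans (hv.le i)
    exact (ball_subset_closedBall.trans (closedBall_subset_closedBall
      (by linarith [hρ0 z (hFS z hz)]))).trans (hsub z (hFS z hz))
  have hball : ∀ z ∈ F, μ (ball z (ρ z)) ≤ ENNReal.ofReal (ρ z) * (G z / θ) := fun z hz => by
    rw [← mul_div_assoc, ENNReal.le_div_iff_mul_le (Or.inl hθ0) (Or.inl hθt), mul_comm]
    exact (hdens z hz).trans (hg z hz)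
  have hsmall : ∑ z ∈ F, μ (ball z (4 * ρ z)) < δ / 2 := by
    refine lt_of_le_of_lt ?_ hsδ
    calc ∑ z ∈ F, μ (ball z (4 * ρ z)) ≤ ∑ z ∈ F, s * (D ^ 2 / θ) * G z := by
          refine Finset.sum_le_sum fun z hz => ?_
          calc μ (ball z (4 * ρ z)) ≤ D ^ 2 * μ (ball z (ρ z)) :=
                h.measure_ball_le (hρ0 z (hFS z hz)) 2 (by rw [dist_self]; linarith)
            _ ≤ D ^ 2 * (s * (G z / θ)) := by
                gcongr
                refine (hball z hz).trans ?_
                gcongr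
                rw [← ENNReal.ofReal_coe_nnreal]
                exact ENNReal.ofReal_le_ofReal (hρlt z (hFS z hz)).1.le
            _ = _ := by simp only [div_eq_mul_inv]; ring
      _ = s * (D ^ 2 / θ) * ∑ z ∈ F, G z := (Finset.mul_sum _ _ _).symm
      _ ≤ s * (D ^ 2 / θ) * (P + η) := by gcongr
      _ = _ := mul_assoc _ _ _
  have key := add_half_sum_le isOpen_ball hlsc (hv.lip i) (hv.meas i) (hv.ug i) hτ F
    (fun z hz => hρ0 z (hFS z hz)) (fun z hz => ball_subset_closedBall.trans (hsub z (hFS z hz)))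
    hFdisj (fun z hz => ?_) (by
      rw [← ENNReal.add_halves δ]
      exact ENNReal.add_lt_add hi hsmall)
  · have hsum : (∑ z ∈ F, G z) / 2 ≤ 3 * η := by
      refine (ENNReal.add_le_add_iff_left hP).1 (key.trans ?_)
      calc ENNReal.ofReal (1 + (τ : ℝ)) * ∫⁻ y in Ω, g i y ∂μ + η
          ≤ ENNReal.ofReal (1 + (τ : ℝ)) * (P + η) + η := by gcongr; exact hv.le i
        _ = (P + η) + τ * (P + η) + η := by rw [h1τ]; ring
        _ ≤ (P + η) + η + η := by gcongr
        _ = _ := by ring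
    have hsum6 : ∑ z ∈ F, G z ≤ 6 * η := by
      rw [ENNReal.div_le_iff (by norm_num) (by norm_num)] at hsum
      refine hsum.trans (le_of_eq ?_)
      ring
    calc ∑ z ∈ F, μ (ball z (5 * (4 * ρ z))) / ENNReal.ofReal (5 * (4 * ρ z))
        ≤ ∑ z ∈ F, D ^ 5 / θ * G z := by
          refine Finset.sum_le_sum fun z hz => ENNReal.div_le_of_le_mul ?_
          have h0 := hρ0 z (hFS z hz)
          calc μ (ball z (5 * (4 * ρ z))) ≤ D ^ 5 * μ (ball z (ρ z)) :=
                h.measure_ball_le h0 5 (by rw [dist_self]; linarith)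
            _ ≤ D ^ 5 * (ENNReal.ofReal (5 * (4 * ρ z)) * (G z / θ)) := by
                gcongr
                refine (hball z hz).trans ?_
                gcongr
                linarith
            _ = _ := by simp only [div_eq_mul_inv]; ring
      _ = D ^ 5 / θ * ∑ z ∈ F, G z := (Finset.mul_sum _ _ _).symm
      _ ≤ D ^ 5 / θ * (6 * η) := by gcongr
      _ = c * η := by rw [hc, mul_assoc]
      _ ≤ ε := hcη
  · have h0 := hρ0 z (hFS z hz)
    calc ENNReal.ofReal (2 * ρ z)⁻¹ * μ (ball z (4 * ρ z) ∩ _)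
        ≤ ENNReal.ofReal (2 * ρ z)⁻¹ * (ENNReal.ofReal (ρ z) * G z) := by
          gcongr
          exact (hl z hz).trans (hg z hz)
      _ = G z / 2 := by
          rw [← mul_assoc, ← ENNReal.ofReal_mul (by positivity),
            show (2 * ρ z)⁻¹ * ρ z = 2⁻¹ by field_simp, ENNReal.ofReal_inv_of_pos two_pos,
            ENNReal.ofReal_ofNat, ← ENNReal.div_eq_inv_mul]

theorem MMS.hasCover_sparsePoints [BorelSpace X] (h : MMS μ Cd CP lam) {E : Set X}
    (hE : MeasurableSet E) {x : X} {r T : ℝ} (hr : 0 < r) (hT : 0 < T)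
    (hP : perim μ E (ball x (2 * r)) ≠ ⊤) {n k : ℕ} (hn : 5 * lam ≤ 2 ^ n) (hk : 32 * lam ≤ 2 ^ k)
    (hk' : 1024 * Cd ^ (n + 3) * CP ≤ 2 ^ k) {ε : ℝ≥0∞} (hε : ε ≠ 0) :
    HasCover μ x r T {z | z ∈ ball x r ∧
      ∃ θ, θ ≠ 0 ∧ 4 * ENNReal.ofReal Cd ^ k * θ ≤ 1 ∧ IsSparseAt μ E θ z} ε := by
  obtain ⟨ε', hε'0, hε'⟩ := ENNReal.exists_pos_sum_of_countable' hε ℕ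
  refine (HasCover.iUnion fun m : ℕ => h.hasCover_of_isSparseAt hE hr hT hP hn hk hk'
    (θ := ((m : ℝ≥0∞) + 1)⁻¹) (by simp) (by simp) (hε'0 m).ne'
    (S := {z | z ∈ ball x r ∧ ∃ θ, ((m : ℝ≥0∞) + 1)⁻¹ ≤ θ ∧
      4 * ENNReal.ofReal Cd ^ k * θ ≤ 1 ∧ IsSparseAt μ E θ z}) (fun z hz => hz.1)
    fun z hz => hz.2).mono ?_ hε'.le
  rintro z ⟨hz, θ, hθ, h1, h2⟩
  obtain ⟨m, hm⟩ := ENNReal.exists_inv_nat_lt hθ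
  refine mem_iUnion.2 ⟨m, hz, θ, le_trans ?_ hm.le, h1, h2⟩
  exact ENNReal.inv_le_inv.2 le_self_add

end SparsePoints

/-! ### Points of large density -/

section DensePoints

variable {μ : Measure X} {Cd CP lam : ℝ}

theorem MMS.hasCover_densePoints [BorelSpace X] (h : MMS μ Cd CP lam) {E : Set X}
    (hE : MeasurableSet E) {x : X} {r : ℝ} (hr : 0 < r) {N n : ℕ} (hN : 128 * lam ≤ 2 ^ N)
    (hsmall : μ (E ∩ ball x (2 * r)) ≤ μ (ball x (2 * r)) / ENNReal.ofReal (2 * Cd ^ N))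
    (hn : 5 * lam ≤ 2 ^ n) {Q : ℝ≥0∞} (hQ : 2 * ENNReal.ofReal Cd ≤ Q) (hQt : Q ≠ ⊤) {M : ℝ≥0∞}
    (hM : perim μ E (ball x (2 * r)) < M) :
    HasCover μ x r (5 * r / 16) {z | z ∈ ball x r ∧ ∀ s : ℝ, 0 < s → ∃ ρ, 0 < ρ ∧ ρ < s ∧
        μ (ball z ρ) ≤ Q * μ (E ∩ ball z ρ)}
      (2 * Q * ENNReal.ofReal Cd ^ n * ENNReal.ofReal CP * M) := by
  set Ω := ball x (2 * r) with hΩ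
  set D := ENNReal.ofReal Cd with hD
  set S := {z | z ∈ ball x r ∧ ∀ s : ℝ, 0 < s → ∃ ρ, 0 < ρ ∧ ρ < s ∧
    μ (ball z ρ) ≤ Q * μ (E ∩ ball z ρ)} with hS
  have hD1 : 1 ≤ D := h.one_le_ofReal
  have hl : 0 < lam := lt_of_lt_of_le one_pos h.hlam
  have hN0 : (0 : ℝ) < 2 ^ N := by positivity
  set t₀ : ℝ := 4 * r / 2 ^ N with ht₀
  have ht₀0 : 0 < t₀ := by positivity
  have hNt : 2 ^ N * t₀ = 4 * r := by rw [ht₀]; field_simp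
  have hlt₀ : 2 * (lam * t₀) ≤ r / 16 := by nlinarith
  have hbig : ∀ z ∈ ball x r, ∀ t, t₀ ≤ t → 2 * μ (E ∩ Ω ∩ ball z t) ≤ μ (ball z t) := by
    intro z hz t ht
    have hD2 : ENNReal.ofReal (2 * Cd ^ N) = 2 * D ^ N := by
      rw [ENNReal.ofReal_mul zero_le_two, ENNReal.ofReal_ofNat,
        ENNReal.ofReal_pow (zero_le_one.trans h.hCd)]
    have hDN0 : D ^ N ≠ 0 := pow_ne_zero _ (lt_of_lt_of_le one_pos hD1).ne'
    have hDNt : D ^ N ≠ ⊤ := ENNReal.pow_ne_top ENNReal.ofReal_ne_top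
    rw [hD2, ENNReal.le_div_iff_mul_le (Or.inl (mul_ne_zero two_ne_zero hDN0))
      (Or.inl (ENNReal.mul_ne_top (by norm_num) hDNt))] at hsmall
    refine (ENNReal.mul_le_mul_iff_right hDN0 hDNt).1 ?_
    calc D ^ N * (2 * μ (E ∩ Ω ∩ ball z t)) ≤ D ^ N * (2 * μ (E ∩ Ω)) := by
          exact mul_le_mul_right (mul_le_mul_right (measure_mono inter_subset_left) _) _
      _ = μ (E ∩ Ω) * (2 * D ^ N) := by ring
      _ ≤ μ Ω := hsmall
      _ ≤ D ^ N * μ (ball z t₀) := h.measure_ball_le ht₀0 N (by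
          have := mem_ball'.1 hz
          linarith)
      _ ≤ D ^ N * μ (ball z t) := by gcongr
  have hex : ∀ z, ∃ t : ℝ, z ∈ S → 0 < t ∧ t < 2 * t₀ ∧ IsTransition μ E Q z t := by
    intro z
    by_cases hz : z ∈ S
    · obtain ⟨ρ, hρ0, hρ, hden⟩ := hz.2 (min t₀ r) (lt_min ht₀0 hr)
      have hsub : ball z ρ ⊆ Ω := ball_subset_ball' (by
        linarith [mem_ball.1 hz.1, (lt_min_iff.1 hρ).2])
      obtain ⟨t, ht0, ht, htr⟩ := h.exists_isTransition hQ hρ0 (lt_min_iff.1 hρ).1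
        (E := E ∩ Ω) (by rwa [inter_assoc, inter_eq_right.2 hsub]) (hbig z hz.1)
      refine ⟨t, fun _ => ⟨ht0, ht, htr.of_inter (ball_subset_ball' ?_)⟩⟩
      nlinarith [mem_ball.1 hz.1, h.hlam]
    · exact ⟨0, fun hz' => absurd hz' hz⟩
  choose t ht using hex
  have hlt : ∀ z ∈ S, lam * t z ≤ r / 16 := fun z hz => by
    have := mul_le_mul_of_nonneg_left (ht z hz).2.1.le hl.le
    linarith
  have hQ2 : 2 ≤ Q := le_trans (le_mul_of_one_le_right' hD1) hQ
  obtain ⟨u, huS, huc, hcov, hsum⟩ := h.exists_transition_cover hE (Ω := Ω) (U := Ω) hQ2 hQt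
    (fun z hz => (ht z hz).1) (fun z hz => (ht z hz).2.1.le)
    (fun z hz => ball_subset_ball' (by linarith [mem_ball.1 hz.1, hlt z hz]))
    (fun z hz => closedBall_subset_ball' (by linarith [mem_ball.1 hz.1, hlt z hz]))
    (fun z hz => (ht z hz).2.2) hn
  obtain ⟨v, g, hv⟩ := exists_isApprox hM
  refine hasCover_of_finset (ρ := fun z => 5 * lam * t z) huc (fun z hz => ⟨?_, ?_, (huS hz).1⟩)
    hcov fun F hF => ?_
  · have := (ht z (huS hz)).1
    positivity
  · linarith [hlt z (huS hz)]
  · obtain ⟨i, hi⟩ := (hsum M v g hv F hF).exists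
    calc ∑ z ∈ F, μ (ball z (5 * lam * t z)) / ENNReal.ofReal (5 * lam * t z)
        ≤ ∑ z ∈ F, μ (ball z (5 * lam * t z)) / ENNReal.ofReal (t z) := by
          refine Finset.sum_le_sum fun z hz => ENNReal.div_le_div_left
            (ENNReal.ofReal_le_ofReal ?_) _
          nlinarith [(ht z (huS (hF hz))).1, h.hlam]
      _ ≤ _ := hi
      _ ≤ _ := by gcongr; exact hv.le i

theorem MMS.limsup_density_pos (h : MMS μ Cd CP lam) {E : Set X} {z : X}
    (hz : z ∈ measInterior μ E ∪ measBoundary μ E) :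
    0 < limsup (fun r : ℝ => μ (ball z r ∩ E) / μ (ball z r)) (𝓝[>] (0 : ℝ)) := by
  rcases hz with hz | hz
  · by_contra! hcon
    have h4 : (0 : ℝ≥0∞) < 4⁻¹ := by norm_num
    have h1 := eventually_lt_of_limsup_lt (lt_of_le_of_lt hcon h4)
    have h2 := Tendsto.eventually_lt_const h4 hz
    obtain ⟨s, ⟨hs1, hs2⟩, hs0⟩ := ((h1.and h2).and self_mem_nhdsWithin).exists
    have hb := (h.measure_ball_pos z hs0).ne'
    have hbt := (h.measure_ball_lt_top z s).ne
    have : (1 : ℝ≥0∞) < 4⁻¹ + 4⁻¹ := by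
      calc (1 : ℝ≥0∞) = μ (ball z s) / μ (ball z s) := (ENNReal.div_self hb hbt).symm
        _ ≤ (μ (ball z s ∩ E) + μ (ball z s \ E)) / μ (ball z s) :=
            ENNReal.div_le_div_right (measure_le_inter_add_sdiff _ _ _) _
        _ = _ := ENNReal.add_div
        _ < _ := ENNReal.add_lt_add hs1 hs2
    have h5 : (4⁻¹ : ℝ≥0∞) + 4⁻¹ ≤ 1 := by
      calc (4⁻¹ : ℝ≥0∞) + 4⁻¹ ≤ 2⁻¹ + 2⁻¹ := by gcongr <;> norm_num
        _ = 1 := ENNReal.inv_two_add_inv_two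
    exact absurd this (not_lt.2 h5)
  · exact hz.1

/-- A point where `E` has positive upper density is either a point of large density or a sparse
point. -/
theorem MMS.dense_or_isSparseAt (h : MMS μ Cd CP lam) {E : Set X} {z : X} {Q : ℝ≥0∞} (hQ : Q ≠ 0)
    (hQt : Q ≠ ⊤)
    (hz : 0 < limsup (fun r : ℝ => μ (ball z r ∩ E) / μ (ball z r)) (𝓝[>] (0 : ℝ))) :
    (∀ s : ℝ, 0 < s → ∃ ρ, 0 < ρ ∧ ρ < s ∧ μ (ball z ρ) ≤ Q * μ (E ∩ ball z ρ)) ∨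
      ∃ θ, θ ≠ 0 ∧ Q * θ ≤ 1 ∧ IsSparseAt μ E θ z := by
  refine or_iff_not_imp_left.2 fun hd => ?_
  push Not at hd
  obtain ⟨s₀, hs₀, hd⟩ := hd
  set L := limsup (fun r : ℝ => μ (ball z r ∩ E) / μ (ball z r)) (𝓝[>] (0 : ℝ)) with hL
  have hb : ∀ {s : ℝ}, 0 < s → μ (ball z s) ≠ 0 := fun hs => (h.measure_ball_pos z hs).ne'
  have hbt : ∀ s : ℝ, μ (ball z s) ≠ ⊤ := fun s => (h.measure_ball_lt_top z s).ne
  have hLQ : L ≤ Q⁻¹ := by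
    refine limsup_le_of_le (by isBoundedDefault) ?_
    filter_upwards [Ioo_mem_nhdsGT hs₀] with s hs
    refine ENNReal.div_le_of_le_mul ?_
    rw [mul_comm, ← div_eq_mul_inv, ENNReal.le_div_iff_mul_le (Or.inl hQ) (Or.inl hQt), mul_comm,
      inter_comm]
    exact (hd s hs.1 hs.2).le
  have hLt : L ≠ ⊤ := ne_top_of_le_ne_top (ENNReal.inv_ne_top.2 hQ) hLQ
  refine ⟨L, hz.ne', (mul_le_mul_right hLQ Q).trans (ENNReal.mul_inv_cancel hQ hQt).le,
    fun s hs => ?_⟩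
  have hup : ∀ᶠ ρ in 𝓝[>] (0 : ℝ), μ (ball z ρ ∩ E) / μ (ball z ρ) < 2 * L := by
    refine eventually_lt_of_limsup_lt ?_
    rw [two_mul]
    exact ENNReal.lt_add_right hLt hz.ne'
  obtain ⟨ε, hε, hsub⟩ := mem_nhdsGT_iff_exists_Ioo_subset.1 hup
  have hlow : ∃ᶠ ρ in 𝓝[>] (0 : ℝ), L / 2 < μ (ball z ρ ∩ E) / μ (ball z ρ) :=
    frequently_lt_of_lt_limsup (by isBoundedDefault) (ENNReal.half_lt_self hz.ne' hLt)
  have hε' : 0 < min s (ε / 4) := lt_min hs (div_pos hε (by norm_num))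
  obtain ⟨ρ, hρ, hρ0, hρs⟩ := (hlow.and_eventually (Ioo_mem_nhdsGT hε')).exists
  rw [lt_min_iff] at hρs
  refine ⟨ρ, hρ0, hρs.1, ?_, ?_⟩
  · have h4 : (4 * ρ) ∈ Ioo 0 ε := ⟨by positivity, by linarith⟩
    have : _ ≤ 2 * L := le_of_lt (hsub h4)
    rwa [ENNReal.div_le_iff (hb h4.1) (hbt _), inter_comm] at this
  · have := ((ENNReal.lt_div_iff_mul_lt (Or.inl (hb hρ0)) (Or.inl (hbt _))).1 hρ).le
    rw [inter_comm] at this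
    calc L * μ (ball z ρ) = 2 * (L / 2 * μ (ball z ρ)) := by
          rw [← mul_assoc, ENNReal.mul_div_cancel two_ne_zero (by norm_num)]
      _ ≤ _ := by gcongr

end DensePoints

/-! ### From coverings to capacity -/

section Capacity

variable {μ : Measure X} {Cd CP lam : ℝ}

/-- The Lipschitz cut-off function equal to `1` on `ball c R` and to `0` off `ball c (2 * R)`. -/
def bump (p : X × ℝ) (y : X) : ℝ := ramp (2 - dist y p.1 / p.2)

omit [MeasurableSpace X] in
theorem bump_eq_zero {p : X × ℝ} (hp : 0 < p.2) {y : X} (hy : y ∉ ball p.1 (2 * p.2)) :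
    bump p y = 0 := by
  refine ramp_of_le_zero ?_
  rw [mem_ball, not_lt, ← le_div_iff₀ hp] at hy
  linarith

omit [MeasurableSpace X] in
theorem bump_eq_one {p : X × ℝ} (hp : 0 < p.2) {y : X} (hy : y ∈ ball p.1 p.2) :
    bump p y = 1 := by
  refine ramp_of_one_le ?_
  have := (div_lt_one hp).2 (mem_ball.1 hy)
  linarith

omit [MeasurableSpace X] in
theorem abs_bump_sub_le {p : X × ℝ} (hp : 0 < p.2) (y z : X) :
    |bump p y - bump p z| ≤ p.2⁻¹ * dist y z := by
  refine (abs_ramp_sub_le _ _).trans ?_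
  rw [sub_sub_sub_cancel_left, ← sub_div, abs_div, abs_of_pos hp, div_eq_inv_mul, dist_comm y z]
  gcongr
  exact abs_dist_sub_le _ _ _

omit [MeasurableSpace X] in
theorem bump_le_curveIntegral {p : X × ℝ} (hp : 0 < p.2) (γ : Curve X) :
    ENNReal.ofReal |bump p (γ.toFun 1) - bump p (γ.toFun 0)| ≤
      curveIntegral ((ball p.1 (2 * p.2)).indicator fun _ => ENNReal.ofReal p.2⁻¹) γ :=
  lipschitz_le_curveIntegral (inv_nonneg.2 hp.le) (abs_bump_sub_le hp)
    (fun _ hy => Or.inl fun _ => (bump_eq_zero hp hy).trans_le (ramp_nonneg _)) γ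

omit [MeasurableSpace X] in
theorem isUpperGradientOn_iSup_bump {D : Set (X × ℝ)} (hD : ∀ p ∈ D, 0 < p.2) (Ω : Set X) :
    IsUpperGradientOn (fun y => ∑' p : D, (ball p.1.1 (2 * p.1.2)).indicator
      (fun _ => ENNReal.ofReal p.1.2⁻¹) y) (fun y => ⨆ p : D, bump p.1 y) Ω := by
  intro γ _
  set g : X → ℝ≥0∞ := fun y => ∑' p : D, (ball p.1.1 (2 * p.1.2)).indicator
    (fun _ => ENNReal.ofReal p.1.2⁻¹) y with hg
  rcases eq_or_ne (curveIntegral g γ) ⊤ with htop | htop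
  · rw [htop]
    exact le_top
  have hle : ∀ p : D, |bump p.1 (γ.toFun 1) - bump p.1 (γ.toFun 0)| ≤
      (curveIntegral g γ).toReal := fun p =>
    (ENNReal.ofReal_le_iff_le_toReal htop).1 ((bump_le_curveIntegral (hD p.1 p.2) γ).trans
      (curveIntegral_mono (fun y => ENNReal.le_tsum (f := fun p : D =>
        (ball p.1.1 (2 * p.1.2)).indicator (fun _ => ENNReal.ofReal p.1.2⁻¹) y) p) γ))
  have hbdd : ∀ y, BddAbove (range fun p : D => bump p.1 y) := fun y =>
    ⟨1, by rintro _ ⟨p, rfl⟩; exact ramp_le_one _⟩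
  have h0 : ∀ y, 0 ≤ ⨆ p : D, bump p.1 y := fun y => Real.iSup_nonneg fun p => ramp_nonneg _
  have hsup : ∀ a b, (∀ p : D, |bump p.1 a - bump p.1 b| ≤ (curveIntegral g γ).toReal) →
      ⨆ p : D, bump p.1 a ≤ (⨆ p : D, bump p.1 b) + (curveIntegral g γ).toReal := by
    refine fun a b hab => Real.iSup_le (fun p => ?_) (add_nonneg (h0 b) ENNReal.toReal_nonneg)
    have h1 := (abs_le.1 (hab p)).2
    have h2 := le_ciSup (hbdd b) p
    linarith
  rw [ENNReal.ofReal_le_iff_le_toReal htop, abs_le]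
  have h1 := hsup _ _ hle
  have h2 := hsup _ _ fun p => (abs_sub_comm _ _).trans_le (hle p)
  constructor <;> linarith

theorem MMS.vcap1_le_of_hasCover [BorelSpace X] (h : MMS μ Cd CP lam) {x : X} {r T : ℝ}
    (hT : 2 * T ≤ r) {A : Set X} {M : ℝ≥0∞} (hA : HasCover μ x r T A M) :
    vcap1 μ A (ball x (2 * r)) ≤ ENNReal.ofReal Cd * M := by
  have hCd1 := h.one_le_ofReal
  rcases eq_or_ne M ⊤ with rfl | hM
  · rw [ENNReal.mul_top (lt_of_lt_of_le one_pos hCd1).ne']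
    exact le_top
  obtain ⟨D, hDc, hD, hAD, hsum⟩ := hA
  have := hDc.to_subtype
  have hsub : ∀ p ∈ D, ball p.1 (2 * p.2) ⊆ ball x (2 * r) := fun p hp => by
    refine ball_subset_ball' ?_
    have h1 := hD p hp
    have h2 := mem_ball.1 h1.2.2
    linarith
  set u : X → ℝ := fun y => ⨆ p : D, bump p.1 y with hu
  set g : X → ℝ≥0∞ := fun y => ∑' p : D, (ball p.1.1 (2 * p.1.2)).indicator
    (fun _ => ENNReal.ofReal p.1.2⁻¹) y with hg
  have hgm : Measurable g := Measurable.tsum fun p =>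
    measurable_const.indicator measurableSet_ball
  have hug : IsWeakUpperGradientOn μ g u univ :=
    (isUpperGradientOn_iSup_bump (fun p hp => (hD p hp).1) univ).isWeak
  have hgint : ∫⁻ y, g y ∂μ ≤ ENNReal.ofReal Cd * M := by
    rw [hg, lintegral_tsum fun p => (measurable_const.indicator measurableSet_ball).aemeasurable]
    refine le_trans ?_ (mul_le_mul_right hsum _)
    rw [← ENNReal.tsum_mul_left]
    refine ENNReal.tsum_le_tsum fun p => ?_
    have hp := (hD p.1 p.2).1
    rw [lintegral_indicator measurableSet_ball, setLIntegral_const,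
      ENNReal.ofReal_inv_of_pos hp, ← ENNReal.div_eq_inv_mul, ← mul_div_assoc]
    exact ENNReal.div_le_div_right (h.doubling p.1.1 p.1.2 hp).2.1 _
  have hu0 : ∀ y, 0 ≤ u y := fun y => Real.iSup_nonneg fun p => ramp_nonneg _
  have hu1 : ∀ y, u y ≤ 1 := fun y => Real.iSup_le (fun p => ramp_le_one _) zero_le_one
  have huz : ∀ y ∈ (ball x (2 * r))ᶜ, u y = 0 := fun y hy => le_antisymm
    (Real.iSup_le (fun p => (bump_eq_zero (hD p.1 p.2).1
      fun hy' => hy (hsub p.1 p.2 hy')).le) le_rfl) (hu0 y)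
  have hum : Measurable u := by
    refine Measurable.iSup fun p => ?_
    have : LipschitzWith p.1.2⁻¹.toNNReal (bump p.1) := LipschitzWith.of_dist_le' fun y z =>
      abs_bump_sub_le (hD p.1 p.2).1 y z
    exact this.continuous.measurable
  have hui : Integrable u μ := by
    have : IntegrableOn u (ball x (2 * r)) μ :=
      Measure.integrableOn_of_bounded (h.measure_ball_lt_top x _).ne hum.aestronglyMeasurable
        (M := 1) (ae_of_all _ fun y => by rw [Real.norm_of_nonneg (hu0 y)]; exact hu1 y)
    exact this.integrable_of_forall_notMem_eq_zero fun y hy => huz y hy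
  have hlt : ∫⁻ y, g y ∂μ < ⊤ :=
    hgint.trans_lt (ENNReal.mul_lt_top ENNReal.ofReal_lt_top (lt_top_iff_ne_top.2 hM))
  refine le_trans ?_ hgint
  unfold vcap1
  refine iInf₂_le_of_le u ⟨hui, g, hgm, hug, hlt⟩ (iInf₂_le_of_le (fun y hy => ?_) huz
    (iInf₂_le_of_le g hgm (iInf_le _ hug)))
  obtain ⟨p, hp, hyp⟩ := mem_iUnion₂.1 (hAD hy)
  rw [← bump_eq_one (hD p hp).1 hyp]
  exact le_ciSup (f := fun p : D => bump p.1 y) ⟨1, by rintro _ ⟨p, rfl⟩; exact ramp_le_one _⟩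
    ⟨p, hp⟩

end Capacity

theorem MMS.vcap1_le_mul_perim [BorelSpace X] {μ : Measure X} {Cd CP lam : ℝ}
    (h : MMS μ Cd CP lam) {x : X} {r : ℝ} {E : Set X} (hr : 0 < r) (hE : MeasurableSet E)
    {N n k : ℕ} (hN : 128 * lam ≤ 2 ^ N)
    (hsmall : μ (E ∩ ball x (2 * r)) ≤ μ (ball x (2 * r)) / ENNReal.ofReal (2 * Cd ^ N))
    (hn : 5 * lam ≤ 2 ^ n) (hk : 32 * lam ≤ 2 ^ k) (hk' : 1024 * Cd ^ (n + 3) * CP ≤ 2 ^ k) :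
    vcap1 μ ((measInterior μ E ∪ measBoundary μ E) ∩ ball x r) (ball x (2 * r)) ≤
      ENNReal.ofReal (Cd * (2 * (4 * Cd ^ k) * Cd ^ n * CP)) * perim μ E (ball x (2 * r)) := by
  set D := ENNReal.ofReal Cd with hD
  set P := perim μ E (ball x (2 * r)) with hP
  set C : ℝ≥0∞ := 2 * (4 * D ^ k) * D ^ n * ENNReal.ofReal CP with hC
  have hCd : 0 < Cd := one_pos.trans_le h.hCd
  have hCeq : ENNReal.ofReal (Cd * (2 * (4 * Cd ^ k) * Cd ^ n * CP)) = D * C := by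
    rw [ENNReal.ofReal_mul hCd.le, ENNReal.ofReal_mul (by positivity),
      ENNReal.ofReal_mul (by positivity), ENNReal.ofReal_mul zero_le_two,
      ENNReal.ofReal_mul zero_le_four, ENNReal.ofReal_pow hCd.le, ENNReal.ofReal_pow hCd.le,
      ENNReal.ofReal_ofNat, ENNReal.ofReal_ofNat]
  have hD1 : 1 ≤ D := h.one_le_ofReal
  have hD0 : D ≠ 0 := (one_pos.trans_le hD1).ne'
  have hDt : D ≠ ⊤ := ENNReal.ofReal_ne_top
  have hDk0 : 4 * D ^ k ≠ 0 := mul_ne_zero (by norm_num) (pow_ne_zero _ hD0)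
  have hDkt : 4 * D ^ k ≠ ⊤ := ENNReal.mul_ne_top (by norm_num) (ENNReal.pow_ne_top hDt)
  have hC0 : C ≠ 0 := mul_ne_zero (mul_ne_zero (mul_ne_zero two_ne_zero hDk0)
    (pow_ne_zero _ hD0)) (ENNReal.ofReal_pos.2 h.hCP).ne'
  have hCt : C ≠ ⊤ := ENNReal.mul_ne_top (ENNReal.mul_ne_top (ENNReal.mul_ne_top (by norm_num)
    hDkt) (ENNReal.pow_ne_top hDt)) ENNReal.ofReal_ne_top
  have hk0 : k ≠ 0 := by
    rintro rfl
    rw [pow_zero] at hk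
    linarith [h.hlam]
  have hQ : 2 * D ≤ 4 * D ^ k :=
    mul_le_mul' (by norm_num) (le_self_pow hD1 hk0)
  rw [hCeq]
  rcases eq_or_ne P ⊤ with hPt | hPt
  · rw [hPt, ENNReal.mul_top (mul_ne_zero hD0 hC0)]
    exact le_top
  have hcap : ∀ ε : ℝ≥0∞, ε ≠ 0 →
      vcap1 μ ((measInterior μ E ∪ measBoundary μ E) ∩ ball x r) (ball x (2 * r)) ≤
        D * (C * (P + ε) + ε) := by
    intro ε hε
    have hdense := h.hasCover_densePoints hE hr hN hsmall hn hQ hDkt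
      (ENNReal.lt_add_right hPt hε)
    have hsparse := h.hasCover_sparsePoints hE hr (T := 5 * r / 16) (by positivity) hPt hn hk hk' hε
    refine h.vcap1_le_of_hasCover (by linarith) ((hdense.union hsparse).mono ?_ le_rfl)
    rintro z ⟨hz, hzr⟩
    exact (h.dense_or_isSparseAt hDk0 hDkt (h.limsup_density_pos hz)).imp
      (fun hd => ⟨hzr, hd⟩) fun hs => ⟨hzr, hs⟩
  refine ENNReal.le_of_forall_pos_le_add fun ε hε _ => ?_
  obtain ⟨ε', hε', hlt⟩ := ENNReal.exists_nnreal_pos_mul_lt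
    (ENNReal.mul_ne_top hDt (ENNReal.add_ne_top.2 ⟨hCt, ENNReal.one_ne_top⟩))
    (ENNReal.coe_pos.2 hε).ne'
  refine (hcap ε' (ENNReal.coe_pos.2 hε').ne').trans ?_
  calc D * (C * (P + ε') + ε') = D * C * P + ε' * (D * (C + 1)) := by ring
    _ ≤ _ := by gcongr

theorem le_two_pow_ceil_logb {a : ℝ} (ha : 0 < a) : a ≤ 2 ^ ⌈Real.logb 2 a⌉₊ := by
  rw [← Real.rpow_natCast, ← Real.logb_le_iff_le_rpow one_lt_two ha]
  exact Nat.le_ceil _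

/-- **Strengthened local boxing inequality.** If `E` is a measurable set with
`μ(E ∩ B(x,2r))/μ(B(x,2r)) ≤ 1/(2 C_d^{⌈log₂(128λ)⌉})`, then
`cap₁((I_E ∪ ∂*E) ∩ B(x,r), B(x,2r)) ≤ C₃ P(E, B(x,2r))`, where `C₃` depends only on
`C_d`, `C_P`, `λ`. -/
theorem capacity_estimated_by_perimeter :
    ∀ (Cd CP lam : ℝ), ∃ C₃ : ℝ, 0 < C₃ ∧
      ∀ (X : Type*) [MetricSpace X] [MeasurableSpace X] [BorelSpace X]
        (μ : Measure X), MMS μ Cd CP lam →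
        ∀ (x : X) (r : ℝ) (E : Set X), 0 < r → MeasurableSet E →
          μ (E ∩ Metric.ball x (2 * r)) ≤
            μ (Metric.ball x (2 * r)) /
              ENNReal.ofReal (2 * Cd ^ (⌈Real.logb 2 (128 * lam)⌉₊ : ℕ)) →
          vcap1 μ ((measInterior μ E ∪ measBoundary μ E) ∩ Metric.ball x r)
              (Metric.ball x (2 * r)) ≤
            ENNReal.ofReal C₃ * perim μ E (Metric.ball x (2 * r)) := by
  intro Cd CP lam
  by_cases hconst : 1 ≤ Cd ∧ 0 < CP ∧ 1 ≤ lam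
  swap
  · exact ⟨1, one_pos, fun X _ _ _ μ h => absurd ⟨h.hCd, h.hCP, h.hlam⟩ hconst⟩
  obtain ⟨hCd, hCP, hlam⟩ := hconst
  obtain ⟨n, hn⟩ := pow_unbounded_of_one_lt (5 * lam) (one_lt_two (α := ℝ))
  obtain ⟨k, hk⟩ := pow_unbounded_of_one_lt (max (32 * lam) (1024 * Cd ^ (n + 3) * CP))
    (one_lt_two (α := ℝ))
  rw [max_lt_iff] at hk
  refine ⟨Cd * (2 * (4 * Cd ^ k) * Cd ^ n * CP), by positivity, ?_⟩
  intro X _ _ _ μ h x r E hr hE hsmall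
  exact h.vcap1_le_mul_perim hr hE (le_two_pow_ceil_logb (by linarith)) hsmall hn.le hk.1.le hk.2.le

end MetricBV
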